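/- arXiv:1708.03753 — 6 statements merged into one kernel-verified Lean document; each statement's English description precedes it below -/
import Mathlib

section
/- Let d > 0. For every C¹ function φ : ℝ² → ℝ with compact support such that φ(x,y) = −φ(y,x) for all x, y, such that supp φ ⊆ {(x,y) ∈ ℝ² : x ≥ 0, y ≥ 0, |x−y| ≤ d, x+y ≥ d}, and such that φ(x,y) = 0 whenever |x−y| = d, one has ∫_{ℝ²} ‖∇φ(x,y)‖² dx dy ≥ (2π²/d²) ∫_{ℝ²} φ(x,y)² dx dy. -/
open MeasureTheory Real

/-- Squared Euclidean norm of the gradient of `φ : ℝ² → ℝ` at a point. -/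
noncomputable def gradSq (φ : ℝ × ℝ → ℝ) (p : ℝ × ℝ) : ℝ :=
  (fderiv ℝ φ p (1, 0)) ^ 2 + (fderiv ℝ φ p (0, 1)) ^ 2

/-- The Dirichlet eigenvalue bound on `[a, b]` with any constant below the optimal one. -/
theorem sq_mul_integral_sq_le_of_mul_lt_pi {f f' : ℝ → ℝ} {a b μ : ℝ} (hab : a ≤ b) (hμ : 0 ≤ μ)
    (hμπ : μ * (b - a) < π) (hf : ∀ x, HasDerivAt f (f' x) x) (hf' : Continuous f')
    (ha : f a = 0) (hb : f b = 0) :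
    μ ^ 2 * ∫ x in a..b, f x ^ 2 ≤ ∫ x in a..b, f' x ^ 2 := by
  have hfc : Continuous f := continuous_iff_continuousAt.2 fun x => (hf x).continuousAt
  have hcos : ∀ x ∈ Set.Icc a b, cos (μ * (x - (a + b) / 2)) ≠ 0 := by
    rintro x ⟨hx₁, hx₂⟩
    refine (cos_pos_of_mem_Ioo ⟨?_, ?_⟩).ne' <;> nlinarith
  set g : ℝ → ℝ := fun x => -μ * tan (μ * (x - (a + b) / 2)) with hg
  have hgd : ∀ x ∈ Set.Icc a b, HasDerivAt g (-μ ^ 2 - g x ^ 2) x := by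
    intro x hx
    have h₁ : HasDerivAt (fun y : ℝ => μ * (y - (a + b) / 2)) μ x := by
      simpa using ((hasDerivAt_id x).sub_const ((a + b) / 2)).const_mul μ
    have h₂ := ((hasDerivAt_tan (hcos x hx)).comp x h₁).const_mul (-μ)
    refine h₂.congr_deriv ?_
    have hc := hcos x hx
    simp only [hg, tan_eq_sin_div_cos]
    generalize μ * (x - (a + b) / 2) = θ at hc ⊢
    field_simp
    linear_combination μ ^ 2 * sin_sq_add_cos_sq θ
  have hgc : ContinuousOn g (Set.Icc a b) := fun x hx =>
    (hgd x hx).continuousAt.continuousWithinAt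
  have hu : Set.uIcc a b = Set.Icc a b := Set.uIcc_of_le hab
  have hF : ∀ x ∈ Set.uIcc a b, HasDerivAt (fun y => f y ^ 2 * g y)
      (2 * f x * f' x * g x + f x ^ 2 * (-μ ^ 2 - g x ^ 2)) x := by
    intro x hx
    refine (((hf x).pow 2).mul (hgd x (hu ▸ hx))).congr_deriv ?_
    simp
  have hFi : IntervalIntegrable
      (fun x => 2 * f x * f' x * g x + f x ^ 2 * (-μ ^ 2 - g x ^ 2)) volume a b := by
    apply ContinuousOn.intervalIntegrable
    rw [hu]
    fun_prop
  have hint := intervalIntegral.integral_eq_sub_of_hasDerivAt hF hFi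
  have h₁ : IntervalIntegrable (fun x => f' x ^ 2) volume a b :=
    (hf'.pow 2).intervalIntegrable _ _
  have h₂ : IntervalIntegrable (fun x => μ ^ 2 * f x ^ 2) volume a b :=
    (by fun_prop : Continuous fun x => μ ^ 2 * f x ^ 2).intervalIntegrable _ _
  have hnn : 0 ≤ ∫ x in a..b, (f' x ^ 2 - μ ^ 2 * f x ^ 2
      - (2 * f x * f' x * g x + f x ^ 2 * (-μ ^ 2 - g x ^ 2))) :=
    intervalIntegral.integral_nonneg hab fun x _ => by nlinarith [sq_nonneg (f' x - f x * g x)]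
  rw [intervalIntegral.integral_sub (h₁.sub h₂) hFi, intervalIntegral.integral_sub h₁ h₂, hint,
    intervalIntegral.integral_const_mul] at hnn
  simp only [ha, hb] at hnn
  linarith

/-- Wirtinger's inequality for `C¹` functions vanishing at both ends of `[a, b]`. -/
theorem wirtinger_inequality {f f' : ℝ → ℝ} {a b : ℝ} (hab : a < b)
    (hf : ∀ x, HasDerivAt f (f' x) x) (hf' : Continuous f') (ha : f a = 0) (hb : f b = 0) :
    (π / (b - a)) ^ 2 * ∫ x in a..b, f x ^ 2 ≤ ∫ x in a..b, f' x ^ 2 := by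
  have hba : 0 < b - a := sub_pos.2 hab
  have hL : 0 < π / (b - a) := div_pos pi_pos hba
  have ht : Filter.Tendsto (fun μ : ℝ => μ ^ 2 * ∫ x in a..b, f x ^ 2)
      (nhdsWithin (π / (b - a)) (Set.Iio (π / (b - a))))
      (nhds ((π / (b - a)) ^ 2 * ∫ x in a..b, f x ^ 2)) :=
    ((by fun_prop : Continuous fun μ : ℝ => μ ^ 2 * ∫ x in a..b, f x ^ 2).tendsto _).mono_left
      nhdsWithin_le_nhds
  refine le_of_tendsto ht ?_
  filter_upwards [Ioo_mem_nhdsLT hL] with μ hμ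
  exact sq_mul_integral_sq_le_of_mul_lt_pi hab.le hμ.1.le ((lt_div_iff₀ hba).1 hμ.2) hf hf' ha hb

theorem continuous_gradSq {φ : ℝ × ℝ → ℝ} (hφ : ContDiff ℝ 1 φ) : Continuous (gradSq φ) := by
  have := hφ.continuous_fderiv one_ne_zero
  unfold gradSq
  fun_prop

theorem integrable_gradSq {φ : ℝ × ℝ → ℝ} (hφ : ContDiff ℝ 1 φ) (hcs : HasCompactSupport φ) :
    Integrable (gradSq φ) :=
  (continuous_gradSq hφ).integrable_of_hasCompactSupport <|
    (hcs.fderiv ℝ).mono' <| (Function.support_subset_iff'.2 fun p hp => by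
      simp [gradSq, Function.notMem_support.1 hp]).trans subset_closure

theorem integrable_comp_sub_prod {h : ℝ × ℝ → ℝ} (hh : Integrable h) :
    Integrable (fun z : ℝ × ℝ => h (z.1 - z.2, z.2)) (volume.prod volume) :=
  (measurePreserving_sub_prod volume volume).integrable_comp_of_integrable hh

theorem integral_eq_integral_integral_antidiagonal {h : ℝ × ℝ → ℝ} (hh : Integrable h) :
    ∫ p, h p = ∫ c, ∫ v, h (c - v, v) := by
  have hS : MeasurePreserving (fun z : ℝ × ℝ => (z.1 - z.2, z.2)) (volume.prod volume)
      (volume.prod volume) := measurePreserving_sub_prod volume volume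
  have hmap : ∫ p, h p ∂(volume.prod volume) =
      ∫ z : ℝ × ℝ, h (z.1 - z.2, z.2) ∂(volume.prod volume) := by
    conv_lhs => rw [← hS.map_eq]
    exact integral_map hS.measurable.aemeasurable (hS.map_eq.symm ▸ hh.aestronglyMeasurable)
  exact hmap.trans (integral_prod _ (integrable_comp_sub_prod hh))

theorem integral_gradSq_sub_antidiagonal_nonneg {d : ℝ} (hd : 0 < d) {φ : ℝ × ℝ → ℝ}
    (hC1 : ContDiff ℝ 1 φ) (hdiag : ∀ x, φ (x, x) = 0) (hout : ∀ x y, d ≤ |x - y| → φ (x, y) = 0)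
    (c : ℝ) (hint : Integrable fun v =>
      gradSq φ (c - v, v) - 2 * π ^ 2 / d ^ 2 * φ (c - v, v) ^ 2) :
    0 ≤ ∫ v, (gradSq φ (c - v, v) - 2 * π ^ 2 / d ^ 2 * φ (c - v, v) ^ 2) := by
  have hfd := hC1.continuous_fderiv one_ne_zero
  have hgc := continuous_gradSq hC1
  have hφc := hC1.continuous
  set f : ℝ → ℝ := fun v => φ (c - v, v) with hf_def
  set f' : ℝ → ℝ := fun v => fderiv ℝ φ (c - v, v) (-1, 1) with hf'_def
  have hf : ∀ v, HasDerivAt f (f' v) v := by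
    intro v
    have h₁ : HasDerivAt (fun v : ℝ => (c - v, v)) ((-1 : ℝ), (1 : ℝ)) v :=
      ((hasDerivAt_id v).const_sub c).prodMk (hasDerivAt_id v)
    have h₂ := ((hC1.differentiable one_ne_zero) (c - v, v)).hasFDerivAt
    exact HasFDerivAt.comp_hasDerivAt (f := fun v : ℝ => (c - v, v)) v h₂ h₁
  have hf' : Continuous f' := by fun_prop
  have hfc : Continuous f := by fun_prop
  have hle : ∀ v, f' v ^ 2 / 2 ≤ gradSq φ (c - v, v) := by
    intro v
    have : ((-1 : ℝ), (1 : ℝ)) = -(1, 0) + (0, 1) := by simp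
    simp only [hf'_def, gradSq, this, map_add, map_neg]
    nlinarith [sq_nonneg (fderiv ℝ φ (c - v, v) (1, 0) + fderiv ℝ φ (c - v, v) (0, 1))]
  have hgrad : ∀ v, 0 ≤ gradSq φ (c - v, v) := fun v => by unfold gradSq; positivity
  set H : ℝ → ℝ := fun v => gradSq φ (c - v, v) - 2 * π ^ 2 / d ^ 2 * f v ^ 2 with hH
  have hHc : Continuous H := by fun_prop
  have hmid : f (c / 2) = 0 := by
    have := hdiag (c / 2)
    simpa [hf_def, show c - c / 2 = c / 2 by ring] using this
  have hends : ∀ v, v ≤ (c - d) / 2 ∨ (c + d) / 2 ≤ v → f v = 0 := by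
    intro v hv
    refine hout _ _ (le_abs.2 ?_)
    rcases hv with hv | hv
    · left; linarith
    · right; linarith
  have hhalf : ∀ a b, b - a = d / 2 → f a = 0 → f b = 0 → 0 ≤ ∫ v in a..b, H v := by
    intro a b hab ha hb
    have hlt : a < b := by linarith
    have hw := wirtinger_inequality hlt hf hf' ha hb
    have hcst : (π / (b - a)) ^ 2 = 2 * (2 * π ^ 2 / d ^ 2) := by
      rw [hab]; field_simp
    have h₁ : IntervalIntegrable (fun v => f' v ^ 2 / 2) volume a b :=
      (by fun_prop : Continuous fun v => f' v ^ 2 / 2).intervalIntegrable _ _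
    have h₂ : IntervalIntegrable (fun v => 2 * π ^ 2 / d ^ 2 * f v ^ 2) volume a b :=
      (by fun_prop : Continuous fun v => 2 * π ^ 2 / d ^ 2 * f v ^ 2).intervalIntegrable _ _
    have hmono : ∫ v in a..b, (f' v ^ 2 / 2 - 2 * π ^ 2 / d ^ 2 * f v ^ 2) ≤ ∫ v in a..b, H v :=
      intervalIntegral.integral_mono hlt.le (h₁.sub h₂) (hHc.intervalIntegrable _ _)
        fun v => sub_le_sub_right (hle v) _
    rw [intervalIntegral.integral_sub h₁ h₂, intervalIntegral.integral_div,
      intervalIntegral.integral_const_mul] at hmono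
    rw [hcst] at hw
    linarith
  have hIoc : 0 ≤ ∫ v in Set.Ioc ((c - d) / 2) ((c + d) / 2), H v := by
    rw [← intervalIntegral.integral_of_le (by linarith),
      ← intervalIntegral.integral_add_adjacent_intervals (b := c / 2)
        (hHc.intervalIntegrable _ _) (hHc.intervalIntegrable _ _)]
    exact add_nonneg (hhalf _ _ (by ring) (hends _ (.inl le_rfl)) hmid)
      (hhalf _ _ (by ring) hmid (hends _ (.inr le_rfl)))
  have hcompl : 0 ≤ ∫ v in (Set.Ioc ((c - d) / 2) ((c + d) / 2))ᶜ, H v := by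
    refine setIntegral_nonneg measurableSet_Ioc.compl fun v hv => ?_
    have : f v = 0 := hends v <| by
      by_contra! h
      exact hv ⟨h.1, h.2.le⟩
    simpa [hH, this] using hgrad v
  rw [← integral_add_compl measurableSet_Ioc hint]
  exact add_nonneg hIoc hcompl

theorem stmt_0 (d : ℝ) (hd : 0 < d) (φ : ℝ × ℝ → ℝ)
    (hC1 : ContDiff ℝ 1 φ) (hcs : HasCompactSupport φ)
    (hanti : ∀ x y : ℝ, φ (x, y) = - φ (y, x))
    (hsupp : Function.support φ ⊆
      {p : ℝ × ℝ | 0 ≤ p.1 ∧ 0 ≤ p.2 ∧ |p.1 - p.2| ≤ d ∧ d ≤ p.1 + p.2})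
    (hdir : ∀ x y : ℝ, |x - y| = d → φ (x, y) = 0) :
    (2 * π ^ 2 / d ^ 2) * ∫ p : ℝ × ℝ, (φ p) ^ 2 ≤ ∫ p : ℝ × ℝ, gradSq φ p := by
  have hdiag : ∀ x, φ (x, x) = 0 := fun x => by linarith [hanti x x]
  have hout : ∀ x y, d ≤ |x - y| → φ (x, y) = 0 := by
    intro x y h
    by_contra hne
    exact hne (hdir x y (le_antisymm (hsupp hne).2.2.1 h))
  have hφ2 : Integrable fun p => φ p ^ 2 :=
    (hC1.continuous.pow 2).integrable_of_hasCompactSupport <|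
      hcs.mono <| Function.support_subset_iff'.2 fun p hp => by
        simp [Function.notMem_support.1 hp]
  have hgrad := integrable_gradSq hC1 hcs
  have hdiff : Integrable fun p => gradSq φ p - 2 * π ^ 2 / d ^ 2 * φ p ^ 2 :=
    hgrad.sub (hφ2.const_mul _)
  have hsplit : ∫ p, (gradSq φ p - 2 * π ^ 2 / d ^ 2 * φ p ^ 2) =
      (∫ p, gradSq φ p) - 2 * π ^ 2 / d ^ 2 * ∫ p, φ p ^ 2 := by
    rw [integral_sub hgrad (hφ2.const_mul _), integral_const_mul]
  refine sub_nonneg.1 (hsplit ▸ ?_)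
  rw [integral_eq_integral_integral_antidiagonal hdiff]
  refine integral_nonneg_of_ae ?_
  filter_upwards [(integrable_comp_sub_prod hdiff).prod_right_ae] with c hc
  exact integral_gradSq_sub_antidiagonal_nonneg hd hC1 hdiag hout c hc
end

section
/- Let d > 0. For every ε > 0 and every R > 0 there exists a nonzero C^∞ function φ : ℝ² → ℝ with compact support such that φ(x,y) = −φ(y,x) for all x, y, supp φ ⊆ {(x,y) ∈ ℝ² : |x−y| ≤ d, x ≥ R, y ≥ R}, φ(x,y) = 0 whenever |x−y| = d, and ∫_{ℝ²} ‖∇φ‖² < (2π²/d² + ε) ∫_{ℝ²} φ². -/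
open MeasureTheory Real

theorem deriv_smoothTransition_eq_zero {t : ℝ} (ht : t < 0 ∨ 1 < t) :
    deriv Real.smoothTransition t = 0 := by
  rcases ht with ht | ht
  · have : Real.smoothTransition =ᶠ[nhds t] fun _ => (0 : ℝ) := by
      filter_upwards [gt_mem_nhds ht] with s hs
      exact Real.smoothTransition.zero_of_nonpos hs.le
    rw [this.deriv_eq, deriv_const]
  · have : Real.smoothTransition =ᶠ[nhds t] fun _ => (1 : ℝ) := by
      filter_upwards [lt_mem_nhds ht] with s hs
      exact Real.smoothTransition.one_of_one_le hs.le
    rw [this.deriv_eq, deriv_const]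

theorem exists_bound_deriv_smoothTransition :
    ∃ M : ℝ, 0 ≤ M ∧ ∀ t, |deriv Real.smoothTransition t| ≤ M := by
  have hc : HasCompactSupport (deriv Real.smoothTransition) := by
    refine HasCompactSupport.intro (isCompact_Icc (a := (0 : ℝ)) (b := 1)) fun t ht => ?_
    rw [Set.mem_Icc, not_and_or, not_le, not_le] at ht
    exact deriv_smoothTransition_eq_zero ht
  have hcont : Continuous (deriv Real.smoothTransition) :=
    (Real.smoothTransition.contDiff (n := 1)).continuous_deriv le_rfl
  obtain ⟨M, hM⟩ := hcont.bounded_above_of_compact_support hc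
  exact ⟨M, (norm_nonneg _).trans (hM 0), hM⟩

/-- Ground state representation: multiplying a sine of frequency `k` by a cutoff `χ` costs only
the energy of the cutoff. -/
theorem integral_deriv_mul_sin_sq {χ : ℝ → ℝ} (hχ : ContDiff ℝ 1 χ) (hc : HasCompactSupport χ)
    (k : ℝ) :
    ∫ u, (deriv (fun u => χ u * sin (k * u)) u) ^ 2 =
      (∫ u, (deriv χ u * sin (k * u)) ^ 2) + k ^ 2 * ∫ u, (χ u * sin (k * u)) ^ 2 := by
  have hχ' : Continuous (deriv χ) := hχ.continuous_deriv le_rfl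
  have hχ0 : Continuous χ := hχ.continuous
  have hd : ∀ u, HasDerivAt χ (deriv χ u) u := fun u =>
    (hχ.differentiable one_ne_zero u).hasDerivAt
  have hs : ∀ u, HasDerivAt (fun u => sin (k * u)) (k * cos (k * u)) u := fun u => by
    simpa [mul_comm] using ((hasDerivAt_id u).const_mul k).sin
  have hcos : ∀ u, HasDerivAt (fun u => cos (k * u)) (-(k * sin (k * u))) u := fun u => by
    simpa [mul_comm] using ((hasDerivAt_id u).const_mul k).cos
  have hz : ∀ u, u ∉ tsupport χ → χ u = 0 ∧ deriv χ u = 0 := fun u hu =>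
    ⟨image_eq_zero_of_notMem_tsupport hu, by
      by_contra h
      exact hu (support_deriv_subset h)⟩
  have i1 : Integrable fun u => (deriv χ u * sin (k * u)) ^ 2 :=
    Continuous.integrable_of_hasCompactSupport (by fun_prop)
      (HasCompactSupport.intro hc fun u hu => by simp [hz u hu])
  have i2 : Integrable fun u => (χ u * sin (k * u)) ^ 2 :=
    Continuous.integrable_of_hasCompactSupport (by fun_prop)
      (HasCompactSupport.intro hc fun u hu => by simp [hz u hu])
  set B : ℝ → ℝ := fun u => (χ u) ^ 2 * (sin (k * u) * (k * cos (k * u))) with hB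
  set B' : ℝ → ℝ := fun u => 2 * χ u * deriv χ u * (sin (k * u) * (k * cos (k * u))) +
    (χ u) ^ 2 * ((k * cos (k * u)) ^ 2 - k ^ 2 * sin (k * u) ^ 2) with hB'
  have iB : Integrable B :=
    Continuous.integrable_of_hasCompactSupport (by fun_prop)
      (HasCompactSupport.intro hc fun u hu => by simp [hB, hz u hu])
  have iB' : Integrable B' :=
    Continuous.integrable_of_hasCompactSupport (by fun_prop)
      (HasCompactSupport.intro hc fun u hu => by simp [hB', hz u hu])
  have hBd : ∀ u, HasDerivAt B (B' u) u := fun u => by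
    refine (((hd u).pow 2).mul ((hs u).mul ((hcos u).const_mul k))).congr_deriv ?_
    simp only [hB', Nat.cast_ofNat, Pi.mul_apply, Pi.pow_apply]
    ring
  have hB0 : ∫ u, B' u = 0 := integral_eq_zero_of_hasDerivAt_of_integrable hBd iB' iB
  have hpt : ∀ u, (deriv (fun u => χ u * sin (k * u)) u) ^ 2 =
      (deriv χ u * sin (k * u)) ^ 2 + k ^ 2 * (χ u * sin (k * u)) ^ 2 + B' u := fun u => by
    have h : deriv (fun u => χ u * sin (k * u)) u =
        deriv χ u * sin (k * u) + χ u * (k * cos (k * u)) := ((hd u).mul (hs u)).deriv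
    rw [h]
    simp only [hB']
    ring
  simp_rw [hpt]
  have i12 : Integrable fun u =>
      (deriv χ u * sin (k * u)) ^ 2 + k ^ 2 * (χ u * sin (k * u)) ^ 2 := i1.add (i2.const_mul _)
  rw [integral_add i12 iB', integral_add i1 (i2.const_mul _), hB0,
    integral_const_mul, add_zero]

/-- An odd test function on `[-d, d]` almost minimizing the Dirichlet quotient. -/
theorem exists_odd_almost_minimizer {d ε : ℝ} (hd : 0 < d) (hε : 0 < ε) :
    ∃ f : ℝ → ℝ, ContDiff ℝ (⊤ : ℕ∞) f ∧ (∀ u, f (-u) = -f u) ∧ (∀ u, d ≤ |u| → f u = 0) ∧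
      0 < ∫ u, (f u) ^ 2 ∧
      ∫ u, (deriv f u) ^ 2 ≤ (π ^ 2 / d ^ 2 + ε) * ∫ u, (f u) ^ 2 := by
  obtain ⟨M, hM0, hM⟩ := exists_bound_deriv_smoothTransition
  set k : ℝ := π / d with hk
  have hk0 : 0 < k := by positivity
  set C : ℝ := (2 * M * k) ^ 2 with hC
  have hC0 : 0 ≤ C := by positivity
  obtain ⟨η, hη0, hηd, hηC⟩ : ∃ η, 0 < η ∧ η ≤ d / 2 ∧ C * (2 * η) ≤ ε * (d / 16) := by
    refine ⟨min (d / 2) (ε * (d / 16) / (2 * (C + 1))), by positivity, min_le_left _ _, ?_⟩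
    have h1 : min (d / 2) (ε * (d / 16) / (2 * (C + 1))) ≤ ε * (d / 16) / (2 * (C + 1)) :=
      min_le_right _ _
    rw [le_div_iff₀ (by positivity)] at h1
    have h2 : 0 ≤ min (d / 2) (ε * (d / 16) / (2 * (C + 1))) := by positivity
    nlinarith
  set χ : ℝ → ℝ := fun u => Real.smoothTransition ((d ^ 2 - u ^ 2) / (d * η)) with hχ
  have hχs : ∀ n : ℕ∞, ContDiff ℝ n χ := fun n =>
    Real.smoothTransition.contDiff.comp (by fun_prop)
  have hχz : ∀ u, d ≤ |u| → χ u = 0 := fun u hu => by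
    apply Real.smoothTransition.zero_of_nonpos
    apply div_nonpos_of_nonpos_of_nonneg _ (by positivity)
    nlinarith [sq_abs u]
  have hχc : HasCompactSupport χ := by
    refine HasCompactSupport.intro (isCompact_Icc (a := -d) (b := d)) fun u hu => hχz u ?_
    by_contra h
    exact hu (abs_le.1 (not_le.1 h).le)
  have hχd : ∀ u, deriv χ u =
      deriv Real.smoothTransition ((d ^ 2 - u ^ 2) / (d * η)) * (-(2 * u) / (d * η)) := fun u => by
    have h1 : HasDerivAt (fun u : ℝ => (d ^ 2 - u ^ 2) / (d * η)) (-(2 * u) / (d * η)) u := by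
      simpa using ((hasDerivAt_pow 2 u).const_sub (d ^ 2)).div_const (d * η)
    exact (((Real.smoothTransition.contDiff (n := 1)).differentiable one_ne_zero
      _).hasDerivAt.comp u h1).deriv
  have hcut : ∀ u, (deriv χ u * sin (k * u)) ^ 2 ≤
      (Set.Icc (-d) (-d + η)).indicator (fun _ => C) u +
        (Set.Icc (d - η) d).indicator (fun _ => C) u := fun u => by
    have hind : ∀ S : Set ℝ, 0 ≤ S.indicator (fun _ => C) u := fun S =>
      Set.indicator_nonneg (fun _ _ => hC0) u
    by_cases hu : (d ^ 2 - u ^ 2) / (d * η) < 0 ∨ 1 < (d ^ 2 - u ^ 2) / (d * η)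
    · rw [hχd, deriv_smoothTransition_eq_zero hu]
      have := add_nonneg (hind (Set.Icc (-d) (-d + η))) (hind (Set.Icc (d - η) d))
      simpa using this
    · push Not at hu
      obtain ⟨h1, h2⟩ := hu
      rw [le_div_iff₀ (by positivity), zero_mul] at h1
      rw [div_le_iff₀ (by positivity), one_mul] at h2
      have hu1 : |u| ≤ d := abs_le_of_sq_le_sq (by linarith) hd.le
      have hu2 : d - η ≤ |u| := by
        have := sq_abs u
        have := abs_nonneg u
        nlinarith
      have hsin : |sin (k * u)| ≤ k * η := by
        have e : |sin (k * u)| = |sin (k * (d - |u|))| := by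
          have : k * (d - |u|) = π - k * |u| := by rw [hk]; field_simp
          rw [this, sin_pi_sub]
          rcases abs_cases u with ⟨h, _⟩ | ⟨h, _⟩ <;> rw [h]
          rw [mul_neg, sin_neg, abs_neg]
        rw [e]
        refine (abs_sin_le_abs).trans ?_
        rw [abs_of_nonneg (mul_nonneg hk0.le (by linarith))]
        gcongr
        linarith
      have hder : |deriv χ u| ≤ M * (2 / η) := by
        rw [hχd, abs_mul]
        refine mul_le_mul (hM _) ?_ (abs_nonneg _) hM0
        rw [abs_div, abs_neg, abs_mul, abs_two, abs_of_pos (mul_pos hd hη0),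
          div_le_div_iff₀ (by positivity) hη0]
        nlinarith [mul_le_mul_of_nonneg_left hu1 hη0.le]
      have hle : (deriv χ u * sin (k * u)) ^ 2 ≤ C := by
        rw [← sq_abs, abs_mul, hC]
        refine pow_le_pow_left₀ (by positivity) ?_ 2
        calc |deriv χ u| * |sin (k * u)| ≤ (M * (2 / η)) * (k * η) := by gcongr
          _ = 2 * M * k := by field_simp
      refine hle.trans ?_
      rcases abs_cases u with ⟨h, _⟩ | ⟨h, _⟩ <;> rw [h] at hu1 hu2
      · have : u ∈ Set.Icc (d - η) d := ⟨hu2, hu1⟩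
        rw [Set.indicator_of_mem this]
        linarith [hind (Set.Icc (-d) (-d + η))]
      · have : u ∈ Set.Icc (-d) (-d + η) := ⟨by linarith, by linarith⟩
        rw [Set.indicator_of_mem this]
        linarith [hind (Set.Icc (d - η) d)]
  have hIi : ∀ a b c : ℝ, Integrable ((Set.Icc a b).indicator fun _ => c) := fun a b c =>
    (integrable_indicator_iff measurableSet_Icc).2 (integrableOn_const (by simp))
  have hIv : ∀ a b c : ℝ, a ≤ b → ∫ u, (Set.Icc a b).indicator (fun _ => c) u = c * (b - a) :=
    fun a b c hab => by
      rw [integral_indicator measurableSet_Icc, setIntegral_const, Measure.real, Real.volume_Icc,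
        ENNReal.toReal_ofReal (by linarith), smul_eq_mul, mul_comm]
  have hχ1 : Continuous (deriv χ) := (hχs 1).continuous_deriv le_rfl
  have hχ0 : Continuous χ := (hχs 0).continuous
  have hcutI : ∫ u, (deriv χ u * sin (k * u)) ^ 2 ≤ C * (2 * η) := by
    refine (integral_mono_of_nonneg (.of_forall fun u => sq_nonneg _)
      ((hIi (-d) (-d + η) C).add (hIi (d - η) d C)) (.of_forall hcut)).trans_eq ?_
    simp only [Pi.add_apply]
    rw [integral_add (hIi _ _ _) (hIi _ _ _), hIv _ _ _ (by linarith), hIv _ _ _ (by linarith)]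
    ring
  have hlow : d / 16 ≤ ∫ u, (χ u * sin (k * u)) ^ 2 := by
    have e : d / 16 = ∫ u, (Set.Icc (d / 4) (d / 2)).indicator (fun _ => (1 / 4 : ℝ)) u := by
      rw [hIv _ _ _ (by linarith)]
      ring
    rw [e]
    refine integral_mono (hIi _ _ _) (Continuous.integrable_of_hasCompactSupport (by fun_prop)
      ?_) fun u => ?_
    · exact HasCompactSupport.intro hχc fun u hu => by
        simp [image_eq_zero_of_notMem_tsupport hu]
    · refine Set.indicator_apply_le' (fun hu => ?_) (fun _ => sq_nonneg _)
      obtain ⟨h1, h2⟩ := hu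
      have hone : χ u = 1 := by
        apply Real.smoothTransition.one_of_one_le
        rw [le_div_iff₀ (by positivity)]
        nlinarith
      have hs : 1 / 2 ≤ sin (k * u) := by
        have hku : k * u ≤ π / 2 := by
          calc k * u ≤ k * (d / 2) := by gcongr
            _ = π / 2 := by rw [hk]; field_simp
        refine le_trans ?_ (Real.mul_le_sin (mul_nonneg hk0.le (by linarith)) hku)
        have : 2 / π * (k * u) = 2 * u / d := by rw [hk]; field_simp
        rw [this, le_div_iff₀ hd]
        linarith
      rw [hone, one_mul]
      nlinarith
  refine ⟨fun u => χ u * sin (k * u), (hχs _).mul (by fun_prop), fun u => ?_, fun u hu => ?_,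
    lt_of_lt_of_le (by positivity) hlow, ?_⟩
  · simp [hχ]
  · simp [hχz u hu]
  · rw [integral_deriv_mul_sin_sq (hχs 1) hχc, hk, div_pow, ← hk]
    have := mul_le_mul_of_nonneg_left hlow hε.le
    linarith

/-- A test function far out on the line with small Dirichlet quotient. -/
theorem exists_spread_bump (a : ℝ) {ε : ℝ} (hε : 0 < ε) :
    ∃ g : ℝ → ℝ, ContDiff ℝ (⊤ : ℕ∞) g ∧ HasCompactSupport g ∧ (∀ v, v ≤ a → g v = 0) ∧
      0 < ∫ v, (g v) ^ 2 ∧ ∫ v, (deriv g v) ^ 2 ≤ ε * ∫ v, (g v) ^ 2 := by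
  let G : ContDiffBump (0 : ℝ) := ⟨1, 2, one_pos, one_lt_two⟩
  have hG : ContDiff ℝ (⊤ : ℕ∞) G := G.contDiff
  have hpos : 0 < ∫ v, (G v) ^ 2 := by
    refine Continuous.integral_pos_of_hasCompactSupport_nonneg_nonzero (x := 0)
      (hG.continuous.pow 2) ?_ (fun v => sq_nonneg _) ?_
    · exact HasCompactSupport.intro G.hasCompactSupport fun u hu => by
        simp [image_eq_zero_of_notMem_tsupport hu]
    · have : G 0 = 1 := G.one_of_mem_closedBall (by simp [G])
      simp [this]
  set J : ℝ := ∫ v, (deriv G v) ^ 2 with hJ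
  set I : ℝ := ∫ v, (G v) ^ 2 with hI
  have hJ0 : 0 ≤ J := integral_nonneg fun v => sq_nonneg _
  obtain ⟨l, hl, hlJ⟩ : ∃ l : ℝ, 0 < l ∧ l ^ 2 * J ≤ ε * I := by
    refine ⟨√(ε * I / (J + 1)), Real.sqrt_pos.2 (by positivity), ?_⟩
    rw [Real.sq_sqrt (by positivity), div_mul_eq_mul_div, div_le_iff₀ (by positivity)]
    nlinarith [mul_pos hε hpos]
  set b : ℝ := -2 - l * a with hb
  have hscale : ∀ F : ℝ → ℝ, ∫ v, F (l * v + b) = l⁻¹ * ∫ v, F v := fun F => by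
    rw [Measure.integral_comp_mul_left (fun v => F (v + b)) l, integral_add_right_eq_self F b,
      abs_of_pos (inv_pos.2 hl), smul_eq_mul]
  have hz : ∀ t, 2 ≤ |t| → G t = 0 := fun t ht => G.zero_of_le_dist (by simpa [G] using ht)
  have hder : ∀ v, deriv (fun v => G (l * v + b)) v = l * deriv G (l * v + b) := fun v => by
    have h1 : HasDerivAt (fun v : ℝ => l * v + b) l v := by
      simpa using ((hasDerivAt_id v).const_mul l).add_const b
    rw [mul_comm]
    exact ((hG.differentiable (by simp) _).hasDerivAt.comp v h1).deriv
  refine ⟨fun v => G (l * v + b), hG.comp (by fun_prop), ?_, fun v hv => ?_, ?_, ?_⟩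
  · refine HasCompactSupport.intro (isCompact_Icc (a := (-2 - b) / l) (b := (2 - b) / l))
      fun v hv => hz _ ?_
    by_contra h
    rw [not_le, abs_lt] at h
    refine hv ⟨?_, ?_⟩
    · rw [div_le_iff₀ hl]; linarith
    · rw [le_div_iff₀ hl]; linarith
  · apply hz
    rw [le_abs]
    right
    nlinarith [mul_le_mul_of_nonneg_left hv hl.le]
  · rw [hscale fun v => (G v) ^ 2]
    positivity
  · simp_rw [hder, mul_pow]
    rw [integral_const_mul, hscale fun v => (G v) ^ 2, hscale fun v => (deriv G v) ^ 2]
    calc l ^ 2 * (l⁻¹ * J) = l⁻¹ * (l ^ 2 * J) := by ring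
      _ ≤ l⁻¹ * (ε * I) := by gcongr
      _ = ε * (l⁻¹ * I) := by ring

theorem hasCompactSupport_sub_mul_add {F G : ℝ → ℝ} (hF : HasCompactSupport F)
    (hG : HasCompactSupport G) :
    HasCompactSupport fun p : ℝ × ℝ => F (p.1 - p.2) * G (p.1 + p.2) := by
  refine HasCompactSupport.intro ((hF.isCompact.prod hG.isCompact).image
    (f := fun q : ℝ × ℝ => ((q.1 + q.2) / 2, (q.2 - q.1) / 2)) (by fun_prop)) fun p hp => ?_
  by_contra h
  refine hp ⟨(p.1 - p.2, p.1 + p.2), ⟨subset_tsupport _ (left_ne_zero_of_mul h),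
    subset_tsupport _ (right_ne_zero_of_mul h)⟩, ?_⟩
  ext <;> simp

theorem integrable_sub_mul_add {F G : ℝ → ℝ} (hF : Continuous F) (hFc : HasCompactSupport F)
    (hG : Continuous G) (hGc : HasCompactSupport G) :
    Integrable fun p : ℝ × ℝ => F (p.1 - p.2) * G (p.1 + p.2) :=
  Continuous.integrable_of_hasCompactSupport (by fun_prop) (hasCompactSupport_sub_mul_add hFc hGc)

theorem integral_sub_mul_add {F G : ℝ → ℝ} (hF : Continuous F) (hFc : HasCompactSupport F)
    (hG : Continuous G) (hGc : HasCompactSupport G) :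
    ∫ p : ℝ × ℝ, F (p.1 - p.2) * G (p.1 + p.2) = (1 / 2) * ((∫ u, F u) * ∫ v, G v) := by
  have hint := integrable_sub_mul_add hF hFc hG hGc
  have hc : HasCompactSupport fun q : ℝ × ℝ => F q.2 * G (q.2 + 2 * q.1) := by
    refine HasCompactSupport.intro ((hFc.isCompact.prod hGc.isCompact).image
      (f := fun q : ℝ × ℝ => ((q.2 - q.1) / 2, q.1)) (by fun_prop)) fun p hp => ?_
    by_contra h
    refine hp ⟨(p.2, p.2 + 2 * p.1), ⟨subset_tsupport _ (left_ne_zero_of_mul h),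
      subset_tsupport _ (right_ne_zero_of_mul h)⟩, ?_⟩
    ext <;> simp
  rw [Measure.volume_eq_prod] at hint ⊢
  rw [integral_prod_symm _ hint]
  calc ∫ y, ∫ x, F (x - y) * G (x + y) = ∫ y, ∫ u, F u * G (u + 2 * y) := by
        congr 1 with y
        rw [← integral_sub_right_eq_self (fun u => F u * G (u + 2 * y)) y]
        congr 1 with x
        congr 2
        ring
    _ = ∫ u, ∫ y, F u * G (u + 2 * y) :=
        integral_integral_swap (Continuous.integrable_of_hasCompactSupport (by fun_prop) hc)
    _ = ∫ u, F u * ((1 / 2) * ∫ v, G v) := by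
        congr 1 with u
        rw [integral_const_mul, Measure.integral_comp_mul_left (fun v => G (u + v)) 2,
          integral_add_left_eq_self G u]
        norm_num
    _ = _ := by
        rw [integral_mul_const]
        ring

theorem gradSq_sub_mul_add {f g : ℝ → ℝ} (hf : Differentiable ℝ f) (hg : Differentiable ℝ g)
    (p : ℝ × ℝ) :
    gradSq (fun p => f (p.1 - p.2) * g (p.1 + p.2)) p =
      2 * ((deriv f (p.1 - p.2)) ^ 2 * (g (p.1 + p.2)) ^ 2) +
        2 * ((f (p.1 - p.2)) ^ 2 * (deriv g (p.1 + p.2)) ^ 2) := by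
  have h1 : HasFDerivAt (fun p : ℝ × ℝ => p.1 - p.2)
      (ContinuousLinearMap.fst ℝ ℝ ℝ - ContinuousLinearMap.snd ℝ ℝ ℝ) p :=
    hasFDerivAt_fst.sub hasFDerivAt_snd
  have h2 : HasFDerivAt (fun p : ℝ × ℝ => p.1 + p.2)
      (ContinuousLinearMap.fst ℝ ℝ ℝ + ContinuousLinearMap.snd ℝ ℝ ℝ) p :=
    hasFDerivAt_fst.add hasFDerivAt_snd
  have h3 := ((hf (p.1 - p.2)).hasDerivAt.comp_hasFDerivAt p h1).mul
    ((hg (p.1 + p.2)).hasDerivAt.comp_hasFDerivAt p h2)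
  have h4 : fderiv ℝ (fun p : ℝ × ℝ => f (p.1 - p.2) * g (p.1 + p.2)) p = _ := h3.fderiv
  rw [gradSq, h4]
  simp
  ring

theorem stmt_1 (d : ℝ) (hd : 0 < d) (ε R : ℝ) (hε : 0 < ε) (hR : 0 < R) :
    ∃ φ : ℝ × ℝ → ℝ, φ ≠ 0 ∧ ContDiff ℝ (⊤ : ℕ∞) φ ∧ HasCompactSupport φ ∧
      (∀ x y : ℝ, φ (x, y) = - φ (y, x)) ∧
      (Function.support φ ⊆ {p : ℝ × ℝ | |p.1 - p.2| ≤ d ∧ R ≤ p.1 ∧ R ≤ p.2}) ∧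
      (∀ x y : ℝ, |x - y| = d → φ (x, y) = 0) ∧
      (∫ p : ℝ × ℝ, gradSq φ p) < (2 * π ^ 2 / d ^ 2 + ε) * ∫ p : ℝ × ℝ, (φ p) ^ 2 := by
  have hε' : 0 < ε / 8 := by positivity
  obtain ⟨f, hf, hodd, hfz, hfpos, hfE⟩ := exists_odd_almost_minimizer hd hε'
  obtain ⟨g, hg, hgc, hgz, hgpos, hgE⟩ := exists_spread_bump (2 * R + d) hε'
  have hfc : HasCompactSupport f := by
    refine HasCompactSupport.intro (isCompact_Icc (a := -d) (b := d)) fun u hu => hfz u ?_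
    by_contra h
    exact hu (abs_le.1 (not_le.1 h).le)
  have hsq : ∀ {h : ℝ → ℝ}, HasCompactSupport h → HasCompactSupport fun u => (h u) ^ 2 :=
    fun hh => HasCompactSupport.intro hh fun u hu => by
      simp [image_eq_zero_of_notMem_tsupport hu]
  have hsqc : ∀ {h : ℝ → ℝ}, Continuous h → Continuous fun u => (h u) ^ 2 := fun hh => hh.pow 2
  have hf' : Continuous (deriv f) := hf.continuous_deriv (by simp)
  have hg' : Continuous (deriv g) := hg.continuous_deriv (by simp)
  have hnorm : ∫ p : ℝ × ℝ, (f (p.1 - p.2) * g (p.1 + p.2)) ^ 2 =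
      (1 / 2) * ((∫ u, (f u) ^ 2) * ∫ v, (g v) ^ 2) := by
    simp_rw [mul_pow]
    exact integral_sub_mul_add (hsqc hf.continuous) (hsq hfc) (hsqc hg.continuous) (hsq hgc)
  have henergy : ∫ p : ℝ × ℝ, gradSq (fun p => f (p.1 - p.2) * g (p.1 + p.2)) p =
      (∫ u, (deriv f u) ^ 2) * (∫ v, (g v) ^ 2) +
        (∫ u, (f u) ^ 2) * ∫ v, (deriv g v) ^ 2 := by
    simp_rw [gradSq_sub_mul_add (hf.differentiable (by simp)) (hg.differentiable (by simp))]
    rw [integral_add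
      ((integrable_sub_mul_add (hsqc hf') (hsq hfc.deriv) (hsqc hg.continuous)
        (hsq hgc)).const_mul 2)
      ((integrable_sub_mul_add (hsqc hf.continuous) (hsq hfc) (hsqc hg')
        (hsq hgc.deriv)).const_mul 2),
      integral_const_mul, integral_const_mul,
      integral_sub_mul_add (hsqc hf') (hsq hfc.deriv) (hsqc hg.continuous) (hsq hgc),
      integral_sub_mul_add (hsqc hf.continuous) (hsq hfc) (hsqc hg') (hsq hgc.deriv)]
    ring
  refine ⟨fun p => f (p.1 - p.2) * g (p.1 + p.2), fun h0 => ?_,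
    (hf.comp (by fun_prop)).mul (hg.comp (by fun_prop)), hasCompactSupport_sub_mul_add hfc hgc,
    fun x y => ?_, fun p hp => ?_, fun x y hxy => ?_, ?_⟩
  · have h1 : ∀ p : ℝ × ℝ, f (p.1 - p.2) * g (p.1 + p.2) = 0 := fun p => congrFun h0 p
    simp_rw [h1] at hnorm
    have h2 := mul_pos hfpos hgpos
    simp at hnorm
    rcases hnorm with h | h
    · exact hfpos.ne' h
    · exact hgpos.ne' h
  · simp only
    rw [← neg_sub y x, hodd, add_comm x y, neg_mul]
  · have hp1 : f (p.1 - p.2) ≠ 0 := left_ne_zero_of_mul hp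
    have hp2 : g (p.1 + p.2) ≠ 0 := right_ne_zero_of_mul hp
    have h1 : |p.1 - p.2| ≤ d := by
      by_contra h
      exact hp1 (hfz _ (not_le.1 h).le)
    have h2 : 2 * R + d ≤ p.1 + p.2 := by
      by_contra h
      exact hp2 (hgz _ (not_le.1 h).le)
    have h3 := abs_le.1 h1
    exact ⟨h1, by linarith [h3.1], by linarith [h3.2]⟩
  · simp [hfz _ hxy.ge]
  · rw [hnorm, henergy]
    have h1 := mul_le_mul_of_nonneg_right hfE hgpos.le
    have h2 := mul_le_mul_of_nonneg_left hgE hfpos.le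
    have h3 := mul_pos hε (mul_pos hfpos hgpos)
    have h4 : 2 * π ^ 2 / d ^ 2 = 2 * (π ^ 2 / d ^ 2) := by ring
    rw [h4]
    nlinarith
end

section
/- Let d > 0 and let T := {(x,y) ∈ ℝ² : 0 ≤ x ≤ y ≤ d}. For every function φ : ℝ² → ℝ that is C¹ on an open neighborhood of T and satisfies φ(t,t) = 0 for all t ∈ [0,d], one has ∫_T ‖∇φ‖² ≥ (π²/(2d²)) ∫_T φ². -/
open MeasureTheory Real

/-- One-dimensional Poincaré inequality on an interval of length less than `d`, for a function
vanishing at the right endpoint. -/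
theorem poincare_of_right_eq_zero {f f' : ℝ → ℝ} {a b d : ℝ} (hab : a ≤ b) (hd : b - a < d)
    (hf : ∀ x ∈ Set.Icc a b, HasDerivAt f (f' x) x) (hf' : ContinuousOn f' (Set.Icc a b))
    (hb : f b = 0) :
    π ^ 2 / (4 * d ^ 2) * ∫ x in a..b, f x ^ 2 ≤ ∫ x in a..b, f' x ^ 2 := by
  have hd0 : 0 < d := by linarith
  set k : ℝ := π / (2 * d) with hk
  have hk0 : 0 < k := by positivity
  have hk2 : π ^ 2 / (4 * d ^ 2) = k ^ 2 := by rw [hk]; field_simp; ring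
  have hcos : ∀ x ∈ Set.Icc a b, cos (k * (x - a)) ≠ 0 := by
    intro x hx
    refine (cos_pos_of_mem_Ioo ⟨?_, ?_⟩).ne'
    · have : 0 ≤ k * (x - a) := mul_nonneg hk0.le (by linarith [hx.1])
      linarith [pi_pos]
    · calc k * (x - a) < k * d := by gcongr; linarith [hx.2]
        _ = π / 2 := by rw [hk]; field_simp
  have hfc : ContinuousOn f (Set.Icc a b) := fun x hx => (hf x hx).continuousAt.continuousWithinAt
  have htan : ContinuousOn (fun x => tan (k * (x - a))) (Set.Icc a b) := fun x hx =>
    ((continuousAt_tan.2 (hcos x hx)).comp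
      (f := fun x => k * (x - a)) (by fun_prop)).continuousWithinAt
  have hderiv : ∀ x ∈ Set.uIcc a b, HasDerivAt (fun x => k * tan (k * (x - a)) * f x ^ 2)
      ((f' x + k * tan (k * (x - a)) * f x) ^ 2 - (f' x ^ 2 - k ^ 2 * f x ^ 2)) x := by
    intro x hx
    rw [Set.uIcc_of_le hab] at hx
    have h1 : HasDerivAt (fun x => k * (x - a)) k x := by
      simpa using ((hasDerivAt_id x).sub_const a).const_mul k
    have h2 := ((((hasDerivAt_tan (hcos x hx)).comp x h1).const_mul k).mul ((hf x hx).pow 2))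
    refine h2.congr_deriv ?_
    have hc : 1 / cos (k * (x - a)) ^ 2 = 1 + tan (k * (x - a)) ^ 2 := by
      rw [one_div, ← inv_one_add_tan_sq (hcos x hx), inv_inv]
    simp only [Function.comp, Pi.pow_apply, hc]
    push_cast
    ring
  have hi1 : IntervalIntegrable (fun x => (f' x + k * tan (k * (x - a)) * f x) ^ 2) volume a b := by
    apply ContinuousOn.intervalIntegrable
    rw [Set.uIcc_of_le hab]
    fun_prop
  have hi2 : IntervalIntegrable (fun x => f' x ^ 2) volume a b := by
    apply ContinuousOn.intervalIntegrable
    rw [Set.uIcc_of_le hab]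
    fun_prop
  have hi3 : IntervalIntegrable (fun x => k ^ 2 * f x ^ 2) volume a b := by
    apply ContinuousOn.intervalIntegrable
    rw [Set.uIcc_of_le hab]
    fun_prop
  have hftc := intervalIntegral.integral_eq_sub_of_hasDerivAt hderiv (hi1.sub (hi2.sub hi3))
  rw [intervalIntegral.integral_sub hi1 (hi2.sub hi3), intervalIntegral.integral_sub hi2 hi3,
    intervalIntegral.integral_const_mul] at hftc
  have hpos : 0 ≤ ∫ x in a..b, (f' x + k * tan (k * (x - a)) * f x) ^ 2 :=
    intervalIntegral.integral_nonneg hab fun x _ => sq_nonneg _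
  simp only [hb, sub_self, mul_zero, tan_zero] at hftc
  rw [hk2]
  linarith

/-- One-dimensional Poincaré inequality on an interval of length less than `d`, for a function
vanishing at the left endpoint. -/
theorem poincare_of_left_eq_zero {f f' : ℝ → ℝ} {a b d : ℝ} (hab : a ≤ b) (hd : b - a < d)
    (hf : ∀ x ∈ Set.Icc a b, HasDerivAt f (f' x) x) (hf' : ContinuousOn f' (Set.Icc a b))
    (ha : f a = 0) :
    π ^ 2 / (4 * d ^ 2) * ∫ x in a..b, f x ^ 2 ≤ ∫ x in a..b, f' x ^ 2 := by
  have hneg : ∀ x ∈ Set.Icc (-b) (-a), -x ∈ Set.Icc a b := fun x hx =>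
    ⟨by linarith [hx.2], by linarith [hx.1]⟩
  have h := poincare_of_right_eq_zero (f := fun x => f (-x)) (f' := fun x => -f' (-x))
    (a := -b) (b := -a) (d := d) (by linarith) (by linarith)
    (fun x hx => by
      simpa [Function.comp_def] using (hf (-x) (hneg x hx)).comp x (hasDerivAt_neg x))
    ((hf'.comp continuousOn_neg hneg).neg) (by simpa using ha)
  simpa [intervalIntegral.integral_comp_neg (fun x => f x ^ 2),
    intervalIntegral.integral_comp_neg (fun x => f' x ^ 2)] using h

/-- Comparing set integrals in a product space through the sections over the first factor. -/
theorem setIntegral_prod_mono_left {T : Set (ℝ × ℝ)} (hT : MeasurableSet T) {F G : ℝ × ℝ → ℝ}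
    (hF : IntegrableOn F T) (hG : IntegrableOn G T)
    (h : ∀ᵐ x : ℝ, ∫ y in {y | (x, y) ∈ T}, F (x, y) ≤ ∫ y in {y | (x, y) ∈ T}, G (x, y)) :
    ∫ p in T, F p ≤ ∫ p in T, G p := by
  have hsec (H : ℝ × ℝ → ℝ) (x : ℝ) :
      ∫ y, T.indicator H (x, y) = ∫ y in {y | (x, y) ∈ T}, H (x, y) :=
    integral_indicator (f := fun y => H (x, y)) (measurable_prodMk_left (x := x) hT)
  rw [← integrable_indicator_iff hT, Measure.volume_eq_prod] at hF hG
  rw [← integral_indicator hT, ← integral_indicator hT, Measure.volume_eq_prod,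
    integral_prod _ hF, integral_prod _ hG]
  refine integral_mono_ae hF.integral_prod_left hG.integral_prod_left ?_
  filter_upwards [h] with x hx
  simpa only [hsec] using hx

/-- Comparing set integrals in a product space through the sections over the second factor. -/
theorem setIntegral_prod_mono_right {T : Set (ℝ × ℝ)} (hT : MeasurableSet T) {F G : ℝ × ℝ → ℝ}
    (hF : IntegrableOn F T) (hG : IntegrableOn G T)
    (h : ∀ᵐ y : ℝ, ∫ x in {x | (x, y) ∈ T}, F (x, y) ≤ ∫ x in {x | (x, y) ∈ T}, G (x, y)) :
    ∫ p in T, F p ≤ ∫ p in T, G p := by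
  have hsec (H : ℝ × ℝ → ℝ) (y : ℝ) :
      ∫ x, T.indicator H (x, y) = ∫ x in {x | (x, y) ∈ T}, H (x, y) :=
    integral_indicator (f := fun x => H (x, y)) (measurable_prodMk_right (y := y) hT)
  rw [← integrable_indicator_iff hT, Measure.volume_eq_prod] at hF hG
  rw [← integral_indicator hT, ← integral_indicator hT, Measure.volume_eq_prod,
    integral_prod_symm _ hF, integral_prod_symm _ hG]
  refine integral_mono_ae hF.integral_prod_right hG.integral_prod_right ?_
  filter_upwards [h] with y hy
  simpa only [hsec] using hy

theorem stmt_4 (d : ℝ) (hd : 0 < d)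
    (T : Set (ℝ × ℝ)) (hT : T = {p : ℝ × ℝ | 0 ≤ p.1 ∧ p.1 ≤ p.2 ∧ p.2 ≤ d})
    (φ : ℝ × ℝ → ℝ) (U : Set (ℝ × ℝ)) (hU : IsOpen U) (hTU : T ⊆ U)
    (hφ : ContDiffOn ℝ 1 φ U)
    (hdiag : ∀ t ∈ Set.Icc (0 : ℝ) d, φ (t, t) = 0) :
    (π ^ 2 / (2 * d ^ 2)) * ∫ p in T, (φ p) ^ 2 ≤ ∫ p in T, gradSq φ p := by
  have hmem (x y : ℝ) : (x, y) ∈ T ↔ 0 ≤ x ∧ x ≤ y ∧ y ≤ d := by rw [hT]; rfl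
  have hclosed : IsClosed T := by
    rw [hT]
    exact (isClosed_le continuous_const continuous_fst).inter
      ((isClosed_le continuous_fst continuous_snd).inter
        (isClosed_le continuous_snd continuous_const))
  have hcompact : IsCompact T := by
    refine (isCompact_Icc (a := ((0 : ℝ), (0 : ℝ))) (b := (d, d))).of_isClosed_subset hclosed ?_
    rintro ⟨x, y⟩ hp
    obtain ⟨h1, h2, h3⟩ := (hmem x y).1 hp
    exact ⟨⟨h1, h1.trans h2⟩, ⟨h2.trans h3, h3⟩⟩
  have hmeas : MeasurableSet T := hclosed.measurableSet
  have hφc : ContinuousOn φ T := hφ.continuousOn.mono hTU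
  have hDc : ContinuousOn (fderiv ℝ φ) T :=
    (hφ.continuousOn_fderiv_of_isOpen hU le_rfl).mono hTU
  have hD (v : ℝ × ℝ) : ContinuousOn (fun p => fderiv ℝ φ p v) T := hDc.clm_apply continuousOn_const
  have hdiff : ∀ p ∈ T, HasFDerivAt φ (fderiv ℝ φ p) p := fun p hp =>
    ((hφ.differentiableOn one_ne_zero).differentiableAt (hU.mem_nhds (hTU hp))).hasFDerivAt
  have hI0 : IntegrableOn (fun p => π ^ 2 / (4 * d ^ 2) * φ p ^ 2) T :=
    ((hφc.pow 2).const_mul _).integrableOn_compact hcompact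
  have hI (v : ℝ × ℝ) : IntegrableOn (fun p => (fderiv ℝ φ p v) ^ 2) T :=
    ((hD v).pow 2).integrableOn_compact hcompact
  have hx : ∫ p in T, π ^ 2 / (4 * d ^ 2) * φ p ^ 2 ≤ ∫ p in T, (fderiv ℝ φ p (1, 0)) ^ 2 := by
    refine setIntegral_prod_mono_right hmeas hI0 (hI _) ?_
    filter_upwards [Measure.ae_ne volume d] with y hyd
    by_cases hy : 0 ≤ y ∧ y ≤ d
    · have hs : {x | (x, y) ∈ T} = Set.Icc 0 y := by
        ext x
        simp [hmem, hy.2]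
      have hsT : Set.MapsTo (fun x => (x, y)) (Set.Icc 0 y) T := fun x hx =>
        (hmem x y).2 ⟨hx.1, hx.2, hy.2⟩
      rw [hs, integral_Icc_eq_integral_Ioc, integral_Icc_eq_integral_Ioc,
        ← intervalIntegral.integral_of_le hy.1, ← intervalIntegral.integral_of_le hy.1,
        intervalIntegral.integral_const_mul]
      refine poincare_of_right_eq_zero (f := fun x => φ (x, y)) hy.1
        (by linarith [lt_of_le_of_ne hy.2 hyd]) (fun x hx => ?_)
        ((hD _).comp (by fun_prop) hsT) (hdiag y hy)
      exact (hdiff _ (hsT hx)).comp_hasDerivAt x ((hasDerivAt_id x).prodMk (hasDerivAt_const x y))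
    · have hs : {x | (x, y) ∈ T} = ∅ := by
        ext x
        simp only [Set.mem_ofPred_eq, hmem, Set.mem_empty_iff_false, iff_false]
        exact fun h => hy ⟨h.1.trans h.2.1, h.2.2⟩
      simp [hs]
  have hy : ∫ p in T, π ^ 2 / (4 * d ^ 2) * φ p ^ 2 ≤ ∫ p in T, (fderiv ℝ φ p (0, 1)) ^ 2 := by
    refine setIntegral_prod_mono_left hmeas hI0 (hI _) ?_
    filter_upwards [Measure.ae_ne volume (0 : ℝ)] with x hx0
    by_cases hx : 0 ≤ x ∧ x ≤ d
    · have hs : {y | (x, y) ∈ T} = Set.Icc x d := by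
        ext y
        simp [hmem, hx.1]
      have hsT : Set.MapsTo (fun y => (x, y)) (Set.Icc x d) T := fun y hy =>
        (hmem x y).2 ⟨hx.1, hy.1, hy.2⟩
      rw [hs, integral_Icc_eq_integral_Ioc, integral_Icc_eq_integral_Ioc,
        ← intervalIntegral.integral_of_le hx.2, ← intervalIntegral.integral_of_le hx.2,
        intervalIntegral.integral_const_mul]
      refine poincare_of_left_eq_zero (f := fun y => φ (x, y)) hx.2
        (by linarith [lt_of_le_of_ne hx.1 hx0.symm]) (fun y hy => ?_)
        ((hD _).comp (by fun_prop) hsT) (hdiag x hx)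
      exact (hdiff _ (hsT hy)).comp_hasDerivAt y ((hasDerivAt_const y x).prodMk (hasDerivAt_id y))
    · have hs : {y | (x, y) ∈ T} = ∅ := by
        ext y
        simp only [Set.mem_ofPred_eq, hmem, Set.mem_empty_iff_false, iff_false]
        exact fun h => hx ⟨h.1, h.2.1.trans h.2.2⟩
      simp [hs]
  have hsum : ∫ p in T, gradSq φ p =
      (∫ p in T, (fderiv ℝ φ p (1, 0)) ^ 2) + ∫ p in T, (fderiv ℝ φ p (0, 1)) ^ 2 :=
    integral_add (hI _) (hI _)
  rw [integral_const_mul] at hx hy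
  have hc : π ^ 2 / (2 * d ^ 2) = 2 * (π ^ 2 / (4 * d ^ 2)) := by field_simp; ring
  rw [hsum, hc]
  linarith
end

section
/- Let b > 0 and let Ω_b := {(x,y) ∈ ℝ² : 0 ≤ y ≤ b} ∪ {(x,y) ∈ ℝ² : 0 ≤ x ≤ b} be the cross-shaped domain. For every pair of linearly independent C¹ functions φ₁, φ₂ : ℝ² → ℝ with compact support contained in Ω_b and vanishing on the boundary of Ω_b, there exist real numbers a, c, not both zero, such that ψ := a·φ₁ + c·φ₂ satisfies ∫_{ℝ²} ‖∇ψ‖² ≥ (π²/b²) ∫_{ℝ²} ψ². -/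
open MeasureTheory Real

/-- The cross-shaped domain: union of a horizontal and a vertical strip of width `b`. -/
def CrossDomain (b : ℝ) : Set (ℝ × ℝ) :=
  {p : ℝ × ℝ | 0 ≤ p.2 ∧ p.2 ≤ b} ∪ {p : ℝ × ℝ | 0 ≤ p.1 ∧ p.1 ≤ b}

theorem wirtinger_aux (b k : ℝ) (hb : 0 < b) (hk : 0 < k) (hkb : k < π / b)
    {f f' : ℝ → ℝ} (hf : ∀ x, HasDerivAt f (f' x) x) (hf' : Continuous f')
    (h0 : f 0 = 0) (h1 : f b = 0) :
    k ^ 2 * ∫ x in (0 : ℝ)..b, f x ^ 2 ≤ ∫ x in (0 : ℝ)..b, f' x ^ 2 := by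
  have hfc : Continuous f := continuous_iff_continuousAt.2 fun x => (hf x).continuousAt
  have hkb' : k * b < π := by rwa [lt_div_iff₀ hb] at hkb
  have hcos : ∀ x ∈ Set.uIcc 0 b, cos (k * (x - b / 2)) ≠ 0 := by
    intro x hx
    rw [Set.uIcc_of_le hb.le] at hx
    refine (cos_pos_of_mem_Ioo ⟨?_, ?_⟩).ne' <;> nlinarith [hx.1, hx.2]
  have htan : ContinuousOn (fun x => tan (k * (x - b / 2))) (Set.uIcc 0 b) := fun x hx =>
    ((continuousAt_tan.2 (hcos x hx)).comp (f := fun x => k * (x - b / 2))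
      (by fun_prop)).continuousWithinAt
  have hderiv : ∀ x ∈ Set.uIcc 0 b, HasDerivAt (fun x => k * tan (k * (x - b / 2)) * f x ^ 2)
      ((f' x + k * tan (k * (x - b / 2)) * f x) ^ 2 - (f' x ^ 2 - k ^ 2 * f x ^ 2)) x := by
    intro x hx
    have h := (((hasDerivAt_tan (hcos x hx)).comp x
      (((hasDerivAt_id x).sub_const (b / 2)).const_mul k)).const_mul k).mul ((hf x).pow 2)
    refine h.congr_deriv ?_
    have hc := hcos x hx
    have hs := sin_sq_add_cos_sq (k * (x - b / 2))
    simp only [Function.comp_apply, id, tan_eq_sin_div_cos, Pi.pow_apply, Nat.cast_ofNat]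
    generalize k * (x - b / 2) = θ at hc hs ⊢
    field_simp
    linear_combination (-k ^ 2 * f x ^ 2) * hs
  have hint : ContinuousOn (fun x => (f' x + k * tan (k * (x - b / 2)) * f x) ^ 2)
      (Set.uIcc 0 b) := by fun_prop
  have hint2 : ContinuousOn (fun x => f' x ^ 2 - k ^ 2 * f x ^ 2) (Set.uIcc 0 b) := by fun_prop
  have hftc := intervalIntegral.integral_eq_sub_of_hasDerivAt hderiv
    (hint.sub hint2).intervalIntegrable
  rw [intervalIntegral.integral_sub hint.intervalIntegrable hint2.intervalIntegrable,
    intervalIntegral.integral_sub, intervalIntegral.integral_const_mul] at hftc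
  · have := intervalIntegral.integral_nonneg (μ := volume) hb.le
      fun x _ => sq_nonneg (f' x + k * tan (k * (x - b / 2)) * f x)
    simp only [h0, h1] at hftc
    linarith
  all_goals exact Continuous.intervalIntegrable (by fun_prop) _ _

/-- The sharp Poincaré inequality on an interval with Dirichlet boundary conditions. -/
theorem wirtinger_dirichlet {b : ℝ} (hb : 0 < b)
    {f f' : ℝ → ℝ} (hf : ∀ x, HasDerivAt f (f' x) x) (hf' : Continuous f')
    (h0 : f 0 = 0) (h1 : f b = 0) :
    (π / b) ^ 2 * ∫ x in (0 : ℝ)..b, f x ^ 2 ≤ ∫ x in (0 : ℝ)..b, f' x ^ 2 := by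
  have ht : Filter.Tendsto (fun k : ℝ => k ^ 2 * ∫ x in (0 : ℝ)..b, f x ^ 2)
      (nhdsWithin (π / b) (Set.Iio (π / b))) (nhds ((π / b) ^ 2 * ∫ x in (0 : ℝ)..b, f x ^ 2)) :=
    Continuous.continuousWithinAt (by fun_prop)
  refine le_of_tendsto ht ?_
  filter_upwards [Ioo_mem_nhdsLT (show (0 : ℝ) < π / b by positivity)] with k hk
  exact wirtinger_aux b k hb hk.1 hk.2 hf hf' h0 h1

/-- The sharp Poincaré inequality on an interval for functions of mean zero. -/
theorem wirtinger_mean_zero {b : ℝ} (hb : 0 < b)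
    {f f' : ℝ → ℝ} (hf : ∀ x, HasDerivAt f (f' x) x) (hf' : Continuous f')
    (hmean : ∫ x in (0 : ℝ)..b, f x = 0) :
    (π / b) ^ 2 * ∫ x in (0 : ℝ)..b, f x ^ 2 ≤ ∫ x in (0 : ℝ)..b, f' x ^ 2 := by
  have hfc : Continuous f := continuous_iff_continuousAt.2 fun x => (hf x).continuousAt
  set F : ℝ → ℝ := fun x => ∫ t in (0 : ℝ)..x, f t with hF
  have hFd : ∀ x, HasDerivAt F (f x) x := fun x => hfc.integral_hasStrictDerivAt 0 x |>.hasDerivAt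
  have hFc : Continuous F := continuous_iff_continuousAt.2 fun x => (hFd x).continuousAt
  have hF0 : F 0 = 0 := by simp [hF]
  have hD := wirtinger_dirichlet hb hFd hfc hF0 hmean
  have hparts := intervalIntegral.integral_mul_deriv_eq_deriv_mul (a := 0) (b := b)
    (fun x _ => hf x) (fun x _ => hFd x) (hf'.intervalIntegrable _ _) (hfc.intervalIntegrable _ _)
  have hFb : F b = 0 := hmean
  rw [hF0, hFb] at hparts
  have hk : 0 < π / b := by positivity
  set k := π / b
  have hsq : 0 ≤ ∫ x in (0 : ℝ)..b, (k ^ 2 * F x + f' x) ^ 2 :=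
    intervalIntegral.integral_nonneg hb.le fun x _ => sq_nonneg _
  have hexp : ∫ x in (0 : ℝ)..b, (k ^ 2 * F x + f' x) ^ 2 =
      k ^ 4 * (∫ x in (0 : ℝ)..b, F x ^ 2) + 2 * k ^ 2 * (∫ x in (0 : ℝ)..b, f' x * F x)
        + ∫ x in (0 : ℝ)..b, f' x ^ 2 := by
    rw [← intervalIntegral.integral_const_mul, ← intervalIntegral.integral_const_mul,
      ← intervalIntegral.integral_add, ← intervalIntegral.integral_add]
    · congr 1; ext x; ring
    all_goals exact Continuous.intervalIntegrable (by fun_prop) _ _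
  have hff : ∫ x in (0 : ℝ)..b, f x * f x = ∫ x in (0 : ℝ)..b, f x ^ 2 := by
    simp only [sq]
  have := mul_le_mul_of_nonneg_left hD (sq_nonneg k)
  nlinarith

theorem integral_sub_mean_sq {b : ℝ} (hb : 0 < b) {g : ℝ → ℝ} (hg : Continuous g) :
    ∫ y in (0 : ℝ)..b, (g y - (∫ t in (0 : ℝ)..b, g t) / b) ^ 2 =
      (∫ y in (0 : ℝ)..b, g y ^ 2) - (∫ t in (0 : ℝ)..b, g t) ^ 2 / b := by
  set G := ∫ t in (0 : ℝ)..b, g t with hG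
  have : ∀ y, (g y - G / b) ^ 2 = g y ^ 2 - 2 * (G / b) * g y + (G / b) ^ 2 := fun y => by ring
  simp only [this]
  rw [intervalIntegral.integral_add, intervalIntegral.integral_sub,
    intervalIntegral.integral_const_mul, ← hG]
  · simp only [intervalIntegral.integral_const, smul_eq_mul]
    field_simp
    ring
  all_goals exact Continuous.intervalIntegrable (by fun_prop) _ _

theorem sq_integral_le {b : ℝ} (hb : 0 < b) {g : ℝ → ℝ} (hg : Continuous g) :
    (∫ y in (0 : ℝ)..b, g y) ^ 2 / b ≤ ∫ y in (0 : ℝ)..b, g y ^ 2 := by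
  have h := integral_sub_mean_sq hb hg
  have := intervalIntegral.integral_nonneg (μ := volume) hb.le
    fun x _ => sq_nonneg (g x - (∫ t in (0 : ℝ)..b, g t) / b)
  linarith

theorem hasDerivAt_fst {ψ : ℝ × ℝ → ℝ} (hψ : ContDiff ℝ 1 ψ) (x y : ℝ) :
    HasDerivAt (fun x => ψ (x, y)) (fderiv ℝ ψ (x, y) (1, 0)) x :=
  ((hψ.differentiable one_ne_zero (x, y)).hasFDerivAt).comp_hasDerivAt x
    ((hasDerivAt_id x).prodMk (hasDerivAt_const x y))

theorem hasDerivAt_snd {ψ : ℝ × ℝ → ℝ} (hψ : ContDiff ℝ 1 ψ) (x y : ℝ) :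
    HasDerivAt (fun y => ψ (x, y)) (fderiv ℝ ψ (x, y) (0, 1)) y :=
  ((hψ.differentiable one_ne_zero (x, y)).hasFDerivAt).comp_hasDerivAt y
    ((hasDerivAt_const y x).prodMk (hasDerivAt_id y))

theorem continuous_fderiv_const {ψ : ℝ × ℝ → ℝ} (hψ : ContDiff ℝ 1 ψ) (v : ℝ × ℝ) :
    Continuous fun p => fderiv ℝ ψ p v :=
  (hψ.continuous_fderiv one_ne_zero).clm_apply continuous_const

theorem continuous_integral_snd {g : ℝ × ℝ → ℝ} (hg : Continuous g) (b : ℝ) :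
    Continuous fun x => ∫ y in (0 : ℝ)..b, g (x, y) :=
  intervalIntegral.continuous_parametric_intervalIntegral_of_continuous'
    (f := fun x y => g (x, y)) hg 0 b

theorem hasDerivAt_integral_fst {ψ : ℝ × ℝ → ℝ} (hψ : ContDiff ℝ 1 ψ) (b x₀ : ℝ) :
    HasDerivAt (fun x => ∫ y in (0 : ℝ)..b, ψ (x, y))
      (∫ y in (0 : ℝ)..b, fderiv ℝ ψ (x₀, y) (1, 0)) x₀ := by
  have hc := hψ.continuous
  have hx := continuous_fderiv_const hψ (1, 0)
  obtain ⟨C, hC⟩ := ((isCompact_Icc (a := x₀ - 1) (b := x₀ + 1)).prod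
    (isCompact_uIcc (a := (0 : ℝ)) (b := b))).exists_bound_of_continuousOn hx.continuousOn
  refine (intervalIntegral.hasDerivAt_integral_of_dominated_loc_of_deriv_le
    (F := fun x y => ψ (x, y)) (F' := fun x y => fderiv ℝ ψ (x, y) (1, 0))
    (bound := fun _ => C) (Icc_mem_nhds (by linarith : x₀ - 1 < x₀) (by linarith : x₀ < x₀ + 1))
    ?_ ?_ ?_ ?_ ?_ ?_).2
  · exact .of_forall fun x => Continuous.aestronglyMeasurable (by fun_prop)
  · exact Continuous.intervalIntegrable (by fun_prop) _ _
  · exact Continuous.aestronglyMeasurable (by fun_prop)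
  · exact .of_forall fun y hy x hx => hC (x, y) ⟨hx, Set.uIoc_subset_uIcc hy⟩
  · exact intervalIntegrable_const
  · exact .of_forall fun y _ x _ => hasDerivAt_fst hψ x y

/-- The sharp Poincaré inequality on a square for functions of mean zero. -/
theorem poincare_square {b : ℝ} (hb : 0 < b) {ψ : ℝ × ℝ → ℝ} (hψ : ContDiff ℝ 1 ψ)
    (hmean : ∫ x in (0 : ℝ)..b, ∫ y in (0 : ℝ)..b, ψ (x, y) = 0) :
    (π / b) ^ 2 * ∫ x in (0 : ℝ)..b, ∫ y in (0 : ℝ)..b, ψ (x, y) ^ 2 ≤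
      ∫ x in (0 : ℝ)..b, ∫ y in (0 : ℝ)..b,
        ((fderiv ℝ ψ (x, y) (1, 0)) ^ 2 + (fderiv ℝ ψ (x, y) (0, 1)) ^ 2) := by
  have hc := hψ.continuous
  have hx := continuous_fderiv_const hψ (1, 0)
  have hy := continuous_fderiv_const hψ (0, 1)
  set M : ℝ → ℝ := fun x => ∫ y in (0 : ℝ)..b, ψ (x, y) with hM
  set M' : ℝ → ℝ := fun x => ∫ y in (0 : ℝ)..b, fderiv ℝ ψ (x, y) (1, 0) with hM'
  have hMc : Continuous M :=
    continuous_integral_snd hc b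
  have hM'c : Continuous M' :=
    continuous_integral_snd hx b
  have hA : Continuous fun x => ∫ y in (0 : ℝ)..b, ψ (x, y) ^ 2 :=
    continuous_integral_snd (hc.pow 2) b
  have hX : Continuous fun x => ∫ y in (0 : ℝ)..b, (fderiv ℝ ψ (x, y) (1, 0)) ^ 2 :=
    continuous_integral_snd (hx.pow 2) b
  have hY : Continuous fun x => ∫ y in (0 : ℝ)..b, (fderiv ℝ ψ (x, y) (0, 1)) ^ 2 :=
    continuous_integral_snd (hy.pow 2) b
  have hN := wirtinger_mean_zero hb (hasDerivAt_integral_fst hψ b) hM'c hmean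
  have hX' : ∫ x in (0 : ℝ)..b, M' x ^ 2 / b ≤
      ∫ x in (0 : ℝ)..b, ∫ y in (0 : ℝ)..b, (fderiv ℝ ψ (x, y) (1, 0)) ^ 2 :=
    intervalIntegral.integral_mono_on hb.le
      (Continuous.intervalIntegrable (by fun_prop) _ _) (hX.intervalIntegrable _ _)
      fun x _ => sq_integral_le hb (by fun_prop)
  have hY' : ∫ x in (0 : ℝ)..b, (π / b) ^ 2 * ((∫ y in (0 : ℝ)..b, ψ (x, y) ^ 2) - M x ^ 2 / b) ≤
      ∫ x in (0 : ℝ)..b, ∫ y in (0 : ℝ)..b, (fderiv ℝ ψ (x, y) (0, 1)) ^ 2 := by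
    refine intervalIntegral.integral_mono_on hb.le
      (Continuous.intervalIntegrable (by fun_prop) _ _) (hY.intervalIntegrable _ _) fun x _ => ?_
    have hg : Continuous fun y => ψ (x, y) := by fun_prop
    rw [hM, ← integral_sub_mean_sq hb hg]
    refine wirtinger_mean_zero hb (fun y => (hasDerivAt_snd hψ x y).sub_const _)
      (by fun_prop) ?_
    rw [intervalIntegral.integral_sub (hg.intervalIntegrable _ _) intervalIntegrable_const,
      intervalIntegral.integral_const, smul_eq_mul]
    field_simp
    ring
  have hsplit : ∀ x, ∫ y in (0 : ℝ)..b,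
      ((fderiv ℝ ψ (x, y) (1, 0)) ^ 2 + (fderiv ℝ ψ (x, y) (0, 1)) ^ 2) =
      (∫ y in (0 : ℝ)..b, (fderiv ℝ ψ (x, y) (1, 0)) ^ 2) +
        ∫ y in (0 : ℝ)..b, (fderiv ℝ ψ (x, y) (0, 1)) ^ 2 := fun x =>
    intervalIntegral.integral_add (Continuous.intervalIntegrable (by fun_prop) _ _)
      (Continuous.intervalIntegrable (by fun_prop) _ _)
  simp only [hsplit]
  rw [intervalIntegral.integral_add (hX.intervalIntegrable _ _) (hY.intervalIntegrable _ _)]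
  rw [intervalIntegral.integral_const_mul, intervalIntegral.integral_sub
    (hA.intervalIntegrable _ _) (Continuous.intervalIntegrable (by fun_prop) _ _),
    intervalIntegral.integral_div] at hY'
  rw [intervalIntegral.integral_div] at hX'
  have := div_le_div_of_nonneg_right hN hb.le
  rw [mul_div_assoc] at this
  linarith

theorem eq_zero_of_support_subset_crossDomain {b : ℝ} {ψ : ℝ × ℝ → ℝ}
    (hs : Function.support ψ ⊆ CrossDomain b) {x y : ℝ} (hx : x ∉ Set.Icc 0 b)
    (hy : y ∉ Set.Icc 0 b) : ψ (x, y) = 0 := by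
  by_contra h
  rcases hs h with h | h
  exacts [hy h, hx h]

theorem endpoints_eq_zero_of_continuous {b : ℝ} {f : ℝ → ℝ} (hf : Continuous f)
    (h : ∀ y ∉ Set.Icc 0 b, f y = 0) : f 0 = 0 ∧ f b = 0 := by
  have hcl : IsClosed {y | f y = 0} := isClosed_eq hf continuous_const
  have hsub : closure (Set.Icc 0 b)ᶜ ⊆ {y | f y = 0} := closure_minimal h hcl
  rw [closure_compl, interior_Icc] at hsub
  exact ⟨hsub (by simp), hsub (by simp)⟩

theorem arm_nonneg {b : ℝ} (hb : 0 < b) {f f' r : ℝ → ℝ}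
    (hf : ∀ y, HasDerivAt f (f' y) y) (hf' : Continuous f') (hr : Continuous r)
    (h : ∀ y ∉ Set.Icc 0 b, f y = 0) :
    0 ≤ ∫ y in Set.Icc 0 b, (r y ^ 2 + f' y ^ 2 - (π / b) ^ 2 * f y ^ 2) := by
  have hfc : Continuous f := continuous_iff_continuousAt.2 fun x => (hf x).continuousAt
  obtain ⟨h0, h1⟩ := endpoints_eq_zero_of_continuous hfc h
  have hD := wirtinger_dirichlet hb hf hf' h0 h1
  have hR : 0 ≤ ∫ y in (0 : ℝ)..b, r y ^ 2 :=
    intervalIntegral.integral_nonneg hb.le fun x _ => sq_nonneg _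
  rw [integral_Icc_eq_integral_Ioc, ← intervalIntegral.integral_of_le hb.le,
    intervalIntegral.integral_sub, intervalIntegral.integral_add,
    intervalIntegral.integral_const_mul]
  · linarith
  all_goals exact Continuous.intervalIntegrable (by fun_prop) _ _

theorem setIntegral_square_eq {b : ℝ} (hb : 0 < b) {g : ℝ × ℝ → ℝ}
    (hg : Continuous g) :
    ∫ p in Set.Icc 0 b ×ˢ Set.Icc 0 b, g p =
      ∫ x in (0 : ℝ)..b, ∫ y in (0 : ℝ)..b, g (x, y) := by
  rw [Measure.volume_eq_prod, setIntegral_prod _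
    (hg.continuousOn.integrableOn_compact (isCompact_Icc.prod isCompact_Icc))]
  simp only [integral_Icc_eq_integral_Ioc, ← intervalIntegral.integral_of_le hb.le]

theorem integral_nonneg_of_prod_blocks {h : ℝ × ℝ → ℝ} (hhi : Integrable h) {I : Set ℝ}
    (hIm : MeasurableSet I) (hII : 0 ≤ ∫ p in I ×ˢ I, h p) (hIc : 0 ≤ ∫ p in I ×ˢ Iᶜ, h p)
    (hcI : 0 ≤ ∫ p in Iᶜ ×ˢ I, h p) (hcc : 0 ≤ ∫ p in Iᶜ ×ˢ Iᶜ, h p) : 0 ≤ ∫ p, h p := by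
  have hrow : ∀ s, MeasurableSet s →
      ∫ p in s ×ˢ Set.univ, h p = (∫ p in s ×ˢ I, h p) + ∫ p in s ×ˢ Iᶜ, h p := fun s hs => by
    rw [← setIntegral_union (Set.Disjoint.set_prod_right disjoint_compl_right _ _)
      (hs.prod hIm.compl) hhi.integrableOn hhi.integrableOn, ← Set.prod_union,
      Set.union_compl_self]
  have htot : ∫ p, h p = (∫ p in I ×ˢ Set.univ, h p) + ∫ p in Iᶜ ×ˢ Set.univ, h p := by
    rw [← setIntegral_union (Set.Disjoint.set_prod_left disjoint_compl_right _ _)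
      (hIm.compl.prod .univ) hhi.integrableOn hhi.integrableOn, ← Set.union_prod,
      Set.union_compl_self, Set.univ_prod_univ, setIntegral_univ]
  rw [htot, hrow I hIm, hrow Iᶜ hIm.compl]
  positivity

theorem setIntegral_prod_symm {h : ℝ × ℝ → ℝ} (hhi : Integrable h) (s t : Set ℝ) :
    ∫ p in s ×ˢ t, h p = ∫ y in t, ∫ x in s, h (x, y) := by
  rw [Measure.volume_eq_prod, ← setIntegral_prod_swap, setIntegral_prod]
  · rfl
  · exact Integrable.integrableOn (Integrable.swap hhi)

theorem integrable_sq_of_hasCompactSupport {g : ℝ × ℝ → ℝ} (hg : Continuous g)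
    (hgs : HasCompactSupport g) : Integrable fun p => g p ^ 2 :=
  Continuous.integrable_of_hasCompactSupport (by fun_prop)
    (hgs.comp_left (g := fun t : ℝ => t ^ 2) (by simp))

/-- A test function on the cross whose mean over the central square vanishes has Rayleigh quotient
at least `π² / b²`. -/
theorem crossDomain_rayleigh_bound {b : ℝ} (hb : 0 < b) {ψ : ℝ × ℝ → ℝ} (hψ : ContDiff ℝ 1 ψ)
    (hcs : HasCompactSupport ψ) (hs : Function.support ψ ⊆ CrossDomain b)
    (hmean : ∫ p in Set.Icc 0 b ×ˢ Set.Icc 0 b, ψ p = 0) :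
    (π ^ 2 / b ^ 2) * ∫ p, ψ p ^ 2 ≤ ∫ p, gradSq ψ p := by
  have hc := hψ.continuous
  have hx := continuous_fderiv_const hψ (1, 0)
  have hy := continuous_fderiv_const hψ (0, 1)
  have hcsx : HasCompactSupport fun p => fderiv ℝ ψ p (1, 0) := hcs.fderiv_apply ℝ (1, 0)
  have hcsy : HasCompactSupport fun p => fderiv ℝ ψ p (0, 1) := hcs.fderiv_apply ℝ (0, 1)
  have hgrad : Integrable fun p => (fderiv ℝ ψ p (1, 0)) ^ 2 + (fderiv ℝ ψ p (0, 1)) ^ 2 :=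
    (integrable_sq_of_hasCompactSupport hx hcsx).add (integrable_sq_of_hasCompactSupport hy hcsy)
  have hsq : Integrable fun p => (π / b) ^ 2 * ψ p ^ 2 := (integrable_sq_of_hasCompactSupport hc hcs).const_mul _
  set h : ℝ × ℝ → ℝ := fun p => (fderiv ℝ ψ p (1, 0)) ^ 2 + (fderiv ℝ ψ p (0, 1)) ^ 2 -
    (π / b) ^ 2 * ψ p ^ 2 with hh
  have hhi : Integrable h := hgrad.sub hsq
  set I : Set ℝ := Set.Icc 0 b with hI
  have hIm : MeasurableSet I := measurableSet_Icc
  have hII : 0 ≤ ∫ p in I ×ˢ I, h p := by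
    have hP := poincare_square hb hψ (by rw [← setIntegral_square_eq hb hc, hmean])
    rw [← setIntegral_square_eq hb (g := fun p => ψ p ^ 2) (by fun_prop),
      ← setIntegral_square_eq hb (g := fun p => (fderiv ℝ ψ p (1, 0)) ^ 2 +
        (fderiv ℝ ψ p (0, 1)) ^ 2) (by fun_prop), ← integral_const_mul] at hP
    rw [hh, integral_sub hgrad.integrableOn hsq.integrableOn]
    linarith
  have hcI : 0 ≤ ∫ p in Iᶜ ×ˢ I, h p := by
    have hprod : ∫ p in Iᶜ ×ˢ I, h p = ∫ x in Iᶜ, ∫ y in I, h (x, y) := by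
      rw [Measure.volume_eq_prod]
      exact setIntegral_prod _ hhi.integrableOn
    rw [hprod]
    refine setIntegral_nonneg hIm.compl fun x hx' => ?_
    exact arm_nonneg hb (hasDerivAt_snd hψ x) (by fun_prop)
      (r := fun y => fderiv ℝ ψ (x, y) (1, 0)) (by fun_prop)
      fun y hy' => eq_zero_of_support_subset_crossDomain hs hx' hy'
  have hIc : 0 ≤ ∫ p in I ×ˢ Iᶜ, h p := by
    rw [setIntegral_prod_symm hhi]
    refine setIntegral_nonneg hIm.compl fun y hy' => ?_
    have := arm_nonneg hb (fun x => hasDerivAt_fst hψ x y) (by fun_prop)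
      (r := fun x => fderiv ℝ ψ (x, y) (0, 1)) (by fun_prop)
      fun x hx' => eq_zero_of_support_subset_crossDomain hs hx' hy'
    simpa only [hh, add_comm] using this
  have hcc : 0 ≤ ∫ p in Iᶜ ×ˢ Iᶜ, h p := by
    refine setIntegral_nonneg (hIm.compl.prod hIm.compl) fun p hp => ?_
    have : ψ p = 0 := eq_zero_of_support_subset_crossDomain hs hp.1 hp.2
    simp only [hh, this]
    ring_nf
    positivity
  have hsub : ∫ p, h p = (∫ p, gradSq ψ p) - (π ^ 2 / b ^ 2) * ∫ p, ψ p ^ 2 := by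
    rw [hh, integral_sub hgrad hsq, integral_const_mul, div_pow]
    rfl
  have := integral_nonneg_of_prod_blocks hhi hIm hII hIc hcI hcc
  linarith

theorem stmt_7 (b : ℝ) (hb : 0 < b) (φ₁ φ₂ : ℝ × ℝ → ℝ)
    (h₁C1 : ContDiff ℝ 1 φ₁) (h₂C1 : ContDiff ℝ 1 φ₂)
    (h₁cs : HasCompactSupport φ₁) (h₂cs : HasCompactSupport φ₂)
    (h₁supp : Function.support φ₁ ⊆ CrossDomain b)
    (h₂supp : Function.support φ₂ ⊆ CrossDomain b)
    (h₁bd : ∀ p ∈ frontier (CrossDomain b), φ₁ p = 0)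
    (h₂bd : ∀ p ∈ frontier (CrossDomain b), φ₂ p = 0)
    (hind : LinearIndependent ℝ ![φ₁, φ₂]) :
    ∃ a c : ℝ, (a ≠ 0 ∨ c ≠ 0) ∧
      (π ^ 2 / b ^ 2) * ∫ p : ℝ × ℝ, (a * φ₁ p + c * φ₂ p) ^ 2 ≤
        ∫ p : ℝ × ℝ, gradSq (fun q => a * φ₁ q + c * φ₂ q) p := by
  obtain ⟨a, c, hac, hmean⟩ : ∃ a c : ℝ, (a ≠ 0 ∨ c ≠ 0) ∧
      a * (∫ p in Set.Icc 0 b ×ˢ Set.Icc 0 b, φ₁ p) +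
        c * (∫ p in Set.Icc 0 b ×ˢ Set.Icc 0 b, φ₂ p) = 0 := by
    by_cases h : (∫ p in Set.Icc 0 b ×ˢ Set.Icc 0 b, φ₁ p) = 0
    · exact ⟨1, 0, by simp, by rw [h]; ring⟩
    · exact ⟨-(∫ p in Set.Icc 0 b ×ˢ Set.Icc 0 b, φ₂ p), _, Or.inr h, by ring⟩
  refine ⟨a, c, hac, crossDomain_rayleigh_bound hb (by fun_prop)
    (h₁cs.mul_left.add h₂cs.mul_left) (fun p hp => ?_) ?_⟩
  · by_contra hn
    have h₁ : φ₁ p = 0 := by_contra fun h => hn (h₁supp h)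
    have h₂ : φ₂ p = 0 := by_contra fun h => hn (h₂supp h)
    simp [h₁, h₂] at hp
  · have h₁i := h₁C1.continuous.integrable_of_hasCompactSupport (μ := volume) h₁cs
    have h₂i := h₂C1.continuous.integrable_of_hasCompactSupport (μ := volume) h₂cs
    rw [integral_add (h₁i.const_mul a).integrableOn (h₂i.const_mul c).integrableOn,
      integral_const_mul, integral_const_mul, hmean]
end

section
/- Let d > 0, β > 0, and let μ < 2π²/d². Then lim_{L→∞} (1/L) · ∑_{k=1}^∞ ∑_{l=0}^∞ 1/(exp(β·(2π²k²/d² + π²(2l+1)²/(8L²) − μ)) − 1) = (√2/π) · ∑_{k=1}^∞ ∫_0^∞ 1/(exp(β·2π²k²/d²)·exp(β(x² − μ)) − 1) dx. -/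
open MeasureTheory Real Filter

theorem AntitoneOn.abs_mul_tsum_midpoint_sub_integral_le {f : ℝ → ℝ}
    (anti : AntitoneOn f (Set.Ici 0)) (integrable : IntegrableOn f (Set.Ioi 0))
    (nonneg : ∀ t ∈ Set.Ici (0 : ℝ), 0 ≤ f t) {h : ℝ} (hh : 0 < h) :
    |h * ∑' l : ℕ, f (h * (l + 1 / 2)) - ∫ x in Set.Ioi (0 : ℝ), f x| ≤ h * f 0 := by
  have anti_h : AntitoneOn (fun x => f (h * x)) (Set.Ici 0) := fun x hx y hy hxy =>
    anti (mul_nonneg hh.le hx) (mul_nonneg hh.le hy) (by gcongr)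
  have integrable_h : IntegrableOn (fun x => f (h * x)) (Set.Ioi 0) := by
    rw [integrableOn_Ioi_comp_mul_left_iff f 0 hh]
    simpa using integrable
  have nonneg_h : ∀ t ∈ Set.Ioi (0 : ℝ), 0 ≤ f (h * t) := fun t ht =>
    nonneg _ (mul_nonneg hh.le (le_of_lt ht))
  have summable := anti_h.summable_of_integrableOn_Ioi_zero integrable_h nonneg_h
  have lower := anti_h.integral_le_tsum summable nonneg_h
  have upper := anti_h.tsum_le_integral integrable_h nonneg_h
  have scale := integral_comp_mul_left_Ioi' f 0 hh
  rw [mul_zero, smul_eq_mul] at scale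
  have le_left (l : ℕ) : f (h * (l + 1 / 2)) ≤ f (h * l) :=
    anti (by simp only [Set.mem_Ici]; positivity) (by simp only [Set.mem_Ici]; positivity)
      (by gcongr; linarith)
  have right_le (l : ℕ) : f (h * (l + 1 : ℕ)) ≤ f (h * (l + 1 / 2)) :=
    anti (by simp only [Set.mem_Ici]; positivity) (by simp only [Set.mem_Ici]; positivity)
      (by push_cast; gcongr; linarith)
  have summable_mid : Summable fun l : ℕ => f (h * (l + 1 / 2)) :=
    summable.of_nonneg_of_le
      (fun l => nonneg _ (by simp only [Set.mem_Ici]; positivity)) le_left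
  have mid_le := summable_mid.tsum_le_tsum le_left summable
  have le_mid := ((summable_nat_add_iff 1).2 summable).tsum_le_tsum right_le summable_mid
  have split := summable.tsum_eq_zero_add
  simp only [Nat.cast_zero, mul_zero] at split upper
  rw [← scale, ← mul_sub, abs_mul, abs_of_pos hh]
  gcongr
  rw [abs_le]
  constructor <;> linarith

theorem tendsto_mul_tsum_tsum_midpoint {f : ℕ → ℝ → ℝ}
    (anti : ∀ k, AntitoneOn (f k) (Set.Ici 0))
    (integrable : ∀ k, IntegrableOn (f k) (Set.Ioi 0))
    (nonneg : ∀ k, ∀ t ∈ Set.Ici (0 : ℝ), 0 ≤ f k t)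
    (summable_zero : Summable fun k => f k 0)
    (summable_integral : Summable fun k => ∫ x in Set.Ioi (0 : ℝ), f k x) :
    Tendsto (fun h : ℝ => h * ∑' (k : ℕ) (l : ℕ), f k (h * (l + 1 / 2)))
      (nhdsWithin 0 (Set.Ioi 0)) (nhds (∑' k, ∫ x in Set.Ioi (0 : ℝ), f k x)) := by
  have bound : ∀ h ∈ Set.Ioi (0 : ℝ),
      |h * ∑' (k : ℕ) (l : ℕ), f k (h * (l + 1 / 2)) - ∑' k, ∫ x in Set.Ioi (0 : ℝ), f k x|
        ≤ h * ∑' k, f k 0 := by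
    intro h hh
    have key k := (anti k).abs_mul_tsum_midpoint_sub_integral_le (integrable k) (nonneg k) hh
    have summable_diff : Summable fun k =>
        h * ∑' l : ℕ, f k (h * (l + 1 / 2)) - ∫ x in Set.Ioi (0 : ℝ), f k x :=
      (summable_zero.mul_left h).of_norm_bounded key
    have summable_mid : Summable fun k => h * ∑' l : ℕ, f k (h * (l + 1 / 2)) := by
      simpa using summable_diff.add summable_integral
    rw [← tsum_mul_left, ← summable_mid.tsum_sub summable_integral, ← tsum_mul_left,
      ← Real.norm_eq_abs]
    exact tsum_of_norm_bounded (summable_zero.mul_left h).hasSum key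
  rw [tendsto_iff_norm_sub_tendsto_zero]
  have lim : Tendsto (fun h : ℝ => h * ∑' k, f k 0) (nhdsWithin 0 (Set.Ioi 0)) (nhds 0) := by
    have : Tendsto (fun h : ℝ => h * ∑' k, f k 0) (nhds 0) (nhds (0 * ∑' k, f k 0)) :=
      tendsto_id.mul_const _
    rw [zero_mul] at this
    exact this.mono_left nhdsWithin_le_nhds
  refine squeeze_zero' (Eventually.of_forall fun _ => norm_nonneg _) ?_ lim
  filter_upwards [self_mem_nhdsWithin] with h hh using bound h hh

theorem one_div_exp_sub_one_le {c t : ℝ} (hc : 0 < c) (hct : c ≤ t) :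
    1 / (exp t - 1) ≤ 1 / (1 - exp (-c)) * exp (-t) := by
  have h1 : exp (-c) < 1 := by simpa using hc
  have h2 : exp (-t) ≤ exp (-c) := by gcongr
  have h3 : exp t * exp (-t) = 1 := by rw [← exp_add]; simp
  have h4 : 1 < exp t := by simpa using hc.trans_le hct
  rw [div_mul_eq_mul_div, one_mul, div_le_div_iff₀ (by linarith) (by linarith)]
  linarith [mul_sub (exp (-t)) (exp t) 1, mul_comm (exp t) (exp (-t))]

theorem summable_exp_neg_mul_succ_sq {b : ℝ} (hb : 0 < b) :
    Summable fun k : ℕ => exp (-(b * ((k : ℝ) + 1) ^ 2)) := by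
  have hgeom : Summable fun k : ℕ => exp (k * -b) :=
    summable_exp_nat_mul_iff.2 (neg_lt_zero.2 hb)
  refine hgeom.of_nonneg_of_le (fun k => (exp_pos _).le) fun k => ?_
  gcongr
  nlinarith [mul_nonneg hb.le (Nat.cast_nonneg (α := ℝ) k),
    mul_nonneg (mul_nonneg hb.le (Nat.cast_nonneg (α := ℝ) k)) (Nat.cast_nonneg (α := ℝ) k)]

theorem tendsto_bose_tsum_midpoint {b β μ : ℝ} (hβ : 0 < β) (hb : 0 < b) (hμ : μ < b) :
    Tendsto (fun h : ℝ => h * ∑' (k : ℕ) (l : ℕ),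
        1 / (exp (β * (b * ((k : ℝ) + 1) ^ 2 + (h * (l + 1 / 2)) ^ 2 - μ)) - 1))
      (nhdsWithin 0 (Set.Ioi 0))
      (nhds (∑' k : ℕ, ∫ x in Set.Ioi (0 : ℝ),
        1 / (exp (β * (b * ((k : ℝ) + 1) ^ 2 + x ^ 2 - μ)) - 1))) := by
  have hc : 0 < β * (b - μ) := mul_pos hβ (sub_pos.2 hμ)
  have le_arg (k : ℕ) (x : ℝ) : β * (b - μ) ≤ β * (b * ((k : ℝ) + 1) ^ 2 + x ^ 2 - μ) := by
    have : b * 1 ≤ b * ((k : ℝ) + 1) ^ 2 := by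
      gcongr
      exact one_le_pow₀ (by linarith [Nat.cast_nonneg (α := ℝ) k])
    gcongr
    linarith [sq_nonneg x]
  have pos (k : ℕ) (x : ℝ) : 0 < exp (β * (b * ((k : ℝ) + 1) ^ 2 + x ^ 2 - μ)) - 1 := by
    simpa using hc.trans_le (le_arg k x)
  set C := 1 / (1 - exp (-(β * (b - μ)))) * exp (β * μ)
  have le_gauss (k : ℕ) (x : ℝ) :
      1 / (exp (β * (b * ((k : ℝ) + 1) ^ 2 + x ^ 2 - μ)) - 1) ≤
        C * exp (-(β * b * ((k : ℝ) + 1) ^ 2)) * exp (-β * x ^ 2) := by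
    refine (one_div_exp_sub_one_le hc (le_arg k x)).trans_eq ?_
    simp only [C]
    rw [mul_assoc, mul_assoc, ← exp_add, ← exp_add]
    ring_nf
  have gauss_int := integrable_exp_neg_mul_sq hβ
  have int (k : ℕ) : Integrable fun x : ℝ =>
      1 / (exp (β * (b * ((k : ℝ) + 1) ^ 2 + x ^ 2 - μ)) - 1) := by
    refine (gauss_int.const_mul (C * exp (-(β * b * ((k : ℝ) + 1) ^ 2)))).mono'
      (Measurable.aestronglyMeasurable (by fun_prop)) (Eventually.of_forall fun x => ?_)
    rw [norm_of_nonneg (one_div_pos.2 (pos k x)).le]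
    exact le_gauss k x
  have hsum := (summable_exp_neg_mul_succ_sq (mul_pos hβ hb)).mul_left C
  refine tendsto_mul_tsum_tsum_midpoint
    (f := fun k x => 1 / (exp (β * (b * ((k : ℝ) + 1) ^ 2 + x ^ 2 - μ)) - 1))
    (fun k x hx y hy hxy => ?_) (fun k => (int k).integrableOn)
    (fun k t _ => (one_div_pos.2 (pos k t)).le) ?_ ?_
  · have : 0 ≤ x := hx
    exact one_div_le_one_div_of_le (pos k x) (by gcongr)
  · refine hsum.of_nonneg_of_le (fun k => (one_div_pos.2 (pos k 0)).le) fun k => ?_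
    simpa using le_gauss k 0
  · refine (hsum.mul_right (∫ x in Set.Ioi (0 : ℝ), exp (-β * x ^ 2))).of_nonneg_of_le
      (fun k => integral_nonneg fun x => (one_div_pos.2 (pos k x)).le) fun k => ?_
    rw [← integral_const_mul]
    exact integral_mono (int k).integrableOn (gauss_int.const_mul _).integrableOn (le_gauss k)

theorem stmt_11 (d β μ : ℝ) (hd : 0 < d) (hβ : 0 < β)
    (hμ : μ < 2 * π ^ 2 / d ^ 2) :
    Tendsto (fun L : ℝ => (1 / L) *
        ∑' (k : ℕ) (l : ℕ),
          1 / (Real.exp (β * (2 * π ^ 2 * ((k : ℝ) + 1) ^ 2 / d ^ 2 +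
            π ^ 2 * (2 * (l : ℝ) + 1) ^ 2 / (8 * L ^ 2) - μ)) - 1))
      atTop
      (nhds ((Real.sqrt 2 / π) *
        ∑' (k : ℕ), ∫ x in Set.Ioi (0 : ℝ),
          1 / (Real.exp (β * (2 * π ^ 2 * ((k : ℝ) + 1) ^ 2 / d ^ 2)) *
            Real.exp (β * (x ^ 2 - μ)) - 1))) := by
  have h2 : √2 ^ 2 = 2 := sq_sqrt (by norm_num)
  have h2' : √2 ≠ 0 := by positivity
  have step : Tendsto (fun L : ℝ => π / √2 * L⁻¹) atTop (nhdsWithin 0 (Set.Ioi 0)) := by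
    refine tendsto_nhdsWithin_iff.2 ⟨?_, ?_⟩
    · simpa using tendsto_inv_atTop_zero.const_mul (π / √2)
    · filter_upwards [eventually_gt_atTop 0] with L hL
      simp only [Set.mem_Ioi]
      positivity
  have main := ((tendsto_bose_tsum_midpoint hβ (by positivity) hμ).comp step).const_mul (√2 / π)
  convert main.congr' ?_ using 5 with k
  · refine integral_congr_ae (Eventually.of_forall fun x => ?_)
    simp only [← exp_add]
    ring_nf
  · filter_upwards [eventually_gt_atTop 0] with L hL
    simp only [Function.comp_apply]
    rw [← mul_assoc]
    congr 1
    · field_simp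
    · refine tsum_congr fun k => tsum_congr fun l => ?_
      have : (π / √2 * L⁻¹ * ((l : ℝ) + 1 / 2)) ^ 2 =
          π ^ 2 * (2 * (l : ℝ) + 1) ^ 2 / (8 * L ^ 2) := by
        rw [mul_pow, mul_pow, div_pow, h2]
        field_simp
        ring
      rw [this]
      ring_nf
end

section
/- Let d > 0, β > 0, and set A := 2π²/d². The function μ ↦ ∑_{n=1}^∞ ∫_0^∞ 1/(exp(β·A·n²)·exp(β(x² − μ)) − 1) dx tends to +∞ as μ tends to A from the left; i.e., for every M > 0 there exists ε > 0 such that for all μ with A − ε < μ < A the sum exceeds M. -/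
open MeasureTheory Real

/-- The Bose factor at energy at least `s > 0` is dominated by a multiple of the Boltzmann factor. -/
lemma one_div_exp_sub_one_le_s12 {s y : ℝ} (hs : 0 < s) (hy : s ≤ y) :
    1 / (exp y - 1) ≤ 1 / (1 - exp (-s)) * exp (-y) := by
  have h1 : 0 < 1 - exp (-s) := by
    have : exp (-s) < 1 := exp_lt_one_iff.2 (by linarith)
    linarith
  have h2 : exp (-y) ≤ exp (-s) := exp_le_exp.2 (by linarith)
  have h3 : exp y * exp (-y) = 1 := by rw [← exp_add]; simp
  have h4 : 0 < exp y - 1 := by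
    have : 1 < exp y := one_lt_exp_iff.2 (by linarith)
    linarith
  rw [one_div_mul_eq_div, div_le_div_iff₀ h4 h1]
  nlinarith

lemma one_div_exp_sub_one_nonneg {y : ℝ} (hy : 0 ≤ y) : 0 ≤ 1 / (exp y - 1) :=
  one_div_nonneg.2 (by linarith [one_le_exp hy])

lemma bose_le_gaussian {β δ c x : ℝ} (hβ : 0 < β) (hδ : 0 < δ) (hc : δ ≤ c) :
    1 / (exp (β * (c + x ^ 2)) - 1) ≤
      1 / (1 - exp (-(β * δ))) * exp (-(β * c)) * exp (-β * x ^ 2) := by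
  have h := one_div_exp_sub_one_le_s12 (s := β * δ) (y := β * (c + x ^ 2)) (by positivity)
    (mul_le_mul_of_nonneg_left (by nlinarith [sq_nonneg x]) hβ.le)
  rwa [show -(β * (c + x ^ 2)) = -(β * c) + -β * x ^ 2 by ring, exp_add, ← mul_assoc] at h

lemma integrableOn_bose {β c : ℝ} (hβ : 0 < β) (hc : 0 < c) :
    IntegrableOn (fun x : ℝ ↦ 1 / (exp (β * (c + x ^ 2)) - 1)) (Set.Ioi 0) := by
  refine Integrable.mono' (((integrable_exp_neg_mul_sq hβ).const_mul
    (1 / (1 - exp (-(β * c))) * exp (-(β * c)))).integrableOn) ?_ (.of_forall fun x ↦ ?_)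
  · exact (by fun_prop : Measurable _).aestronglyMeasurable
  · rw [norm_of_nonneg (one_div_exp_sub_one_nonneg (by positivity))]
    exact bose_le_gaussian hβ hc le_rfl

lemma summable_integral_bose {β A δ : ℝ} (hβ : 0 < β) (hA : 0 < A) (hδ : 0 < δ) :
    Summable fun n : ℕ ↦ ∫ x in Set.Ioi (0 : ℝ),
      1 / (exp (β * ((A * (((n : ℝ) + 1) ^ 2 - 1) + δ) + x ^ 2)) - 1) := by
  have hc (n : ℕ) : n * A + δ ≤ A * (((n : ℝ) + 1) ^ 2 - 1) + δ := by
    have : (0 : ℝ) ≤ n := n.cast_nonneg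
    nlinarith [mul_nonneg hA.le this, mul_nonneg hA.le (sq_nonneg (n : ℝ))]
  have hc' (n : ℕ) : δ ≤ A * (((n : ℝ) + 1) ^ 2 - 1) + δ :=
    le_trans (le_add_of_nonneg_left (by positivity)) (hc n)
  have hK : 0 ≤ 1 / (1 - exp (-(β * δ))) :=
    one_div_nonneg.2 (sub_nonneg.2 (exp_le_one_iff.2 (by nlinarith)))
  have hG : Integrable (fun x : ℝ ↦ exp (-β * x ^ 2)) (volume.restrict (Set.Ioi 0)) :=
    (integrable_exp_neg_mul_sq hβ).integrableOn
  have hsum : Summable fun n : ℕ ↦ exp (n * -(β * A)) :=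
    summable_exp_nat_mul_iff.2 (by nlinarith [mul_pos hβ hA])
  refine Summable.of_nonneg_of_le (fun n ↦ integral_nonneg fun x ↦
    one_div_exp_sub_one_nonneg ?_) (fun n ↦ ?_) (hsum.mul_left
      (1 / (1 - exp (-(β * δ))) * ∫ x in Set.Ioi (0 : ℝ), exp (-β * x ^ 2)))
  · have := hc' n
    exact mul_nonneg hβ.le (by nlinarith [sq_nonneg x])
  · calc
      _ ≤ ∫ x in Set.Ioi (0 : ℝ), 1 / (1 - exp (-(β * δ))) *
          exp (-(β * (A * (((n : ℝ) + 1) ^ 2 - 1) + δ))) * exp (-β * x ^ 2) :=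
        integral_mono (integrableOn_bose hβ (hδ.trans_le (hc' n))) (hG.const_mul _)
          fun x ↦ bose_le_gaussian hβ hδ (hc' n)
      _ = 1 / (1 - exp (-(β * δ))) * (∫ x in Set.Ioi (0 : ℝ), exp (-β * x ^ 2)) *
          exp (-(β * (A * (((n : ℝ) + 1) ^ 2 - 1) + δ))) := by
        rw [integral_const_mul]; ring
      _ ≤ _ := by
        refine mul_le_mul_of_nonneg_left (exp_le_exp.2 ?_)
          (mul_nonneg hK (integral_nonneg fun x ↦ (exp_pos _).le))
        nlinarith [mul_le_mul_of_nonneg_left (hc n) hβ.le, mul_pos hβ hδ]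

lemma le_integral_bose {β δ : ℝ} (hβ : 0 < β) (hδ : 0 < δ) (h : 2 * (β * δ) ≤ 1) :
    1 / (4 * β * √δ) ≤ ∫ x in Set.Ioi (0 : ℝ), 1 / (exp (β * (δ + x ^ 2)) - 1) := by
  have hi := integrableOn_bose hβ hδ
  have hs : 0 < √δ := sqrt_pos.2 hδ
  have hsq : √δ * √δ = δ := mul_self_sqrt hδ.le
  calc
    1 / (4 * β * √δ) = ∫ x in Set.Ioc 0 (√δ), 1 / (4 * (β * δ)) := by
      rw [setIntegral_const, measureReal_def, Real.volume_Ioc, sub_zero,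
        ENNReal.toReal_ofReal hs.le, smul_eq_mul]
      nth_rw 3 [← hsq]
      field_simp
    _ ≤ ∫ x in Set.Ioc 0 (√δ), 1 / (exp (β * (δ + x ^ 2)) - 1) := by
      refine setIntegral_mono_on (integrableOn_const (by simp)) (hi.mono_set Set.Ioc_subset_Ioi_self)
        measurableSet_Ioc fun x hx ↦ ?_
      have hx2 : x ^ 2 ≤ δ := by nlinarith [hx.1, hx.2]
      have hy : 0 < β * (δ + x ^ 2) := by positivity
      have hy2 : β * (δ + x ^ 2) ≤ 2 * (β * δ) := by nlinarith
      have he := abs_exp_sub_one_le (x := β * (δ + x ^ 2))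
        (by rw [abs_of_pos hy]; linarith)
      rw [abs_of_pos hy] at he
      have := add_one_le_exp (β * (δ + x ^ 2))
      exact one_div_le_one_div_of_le (by linarith) (by linarith [(abs_le.1 he).2])
    _ ≤ _ := setIntegral_mono_set hi
      (.of_forall fun x ↦ one_div_exp_sub_one_nonneg (by positivity))
      (Set.Ioc_subset_Ioi_self.eventuallyLE)

theorem stmt_12 (d β : ℝ) (hd : 0 < d) (hβ : 0 < β) :
    ∀ M : ℝ, 0 < M → ∃ ε : ℝ, 0 < ε ∧ ∀ μ : ℝ,
      2 * π ^ 2 / d ^ 2 - ε < μ → μ < 2 * π ^ 2 / d ^ 2 →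
      M < ∑' (n : ℕ), ∫ x in Set.Ioi (0 : ℝ),
        1 / (Real.exp (β * (2 * π ^ 2 / d ^ 2) * ((n : ℝ) + 1) ^ 2) *
          Real.exp (β * (x ^ 2 - μ)) - 1) := by
  intro M hM
  have hA : 0 < 2 * π ^ 2 / d ^ 2 := by positivity
  generalize 2 * π ^ 2 / d ^ 2 = A at hA ⊢
  refine ⟨min (1 / (2 * β)) ((1 / (4 * β * M)) ^ 2), by positivity, fun μ h1 h2 ↦ ?_⟩
  obtain ⟨δ, rfl⟩ : ∃ δ, μ = A - δ := ⟨A - μ, by ring⟩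
  have hδ : 0 < δ := by linarith
  have hδ1 : δ < 1 / (2 * β) := by
    linarith [min_le_left (1 / (2 * β)) ((1 / (4 * β * M)) ^ 2)]
  have hδ2 : δ < (1 / (4 * β * M)) ^ 2 := by
    linarith [min_le_right (1 / (2 * β)) ((1 / (4 * β * M)) ^ 2)]
  have hs : 0 < √δ := sqrt_pos.2 hδ
  have hsM : √δ < 1 / (4 * β * M) := (sqrt_lt' (by positivity)).2 hδ2
  have hlow : M < 1 / (4 * β * √δ) := by
    rw [lt_div_iff₀ (by positivity)] at hsM ⊢
    linarith
  have hβδ : 2 * (β * δ) ≤ 1 := by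
    rw [lt_div_iff₀ (by positivity)] at hδ1
    linarith
  have hrw (n : ℕ) (x : ℝ) : exp (β * A * ((n : ℝ) + 1) ^ 2) * exp (β * (x ^ 2 - (A - δ))) =
      exp (β * ((A * (((n : ℝ) + 1) ^ 2 - 1) + δ) + x ^ 2)) := by
    rw [← exp_add]; ring_nf
  simp_rw [hrw]
  refine (hlow.trans_le (le_integral_bose hβ hδ hβδ)).trans_le ?_
  have h0 := (summable_integral_bose hβ hA hδ).le_tsum 0 fun n _ ↦ integral_nonneg fun x ↦
    one_div_exp_sub_one_nonneg (by
      have : (1 : ℝ) ≤ ((n : ℝ) + 1) ^ 2 := one_le_pow₀ (by simp)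
      have := mul_nonneg hA.le (sub_nonneg.2 this)
      positivity)
  simpa using h0
end
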